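/- arXiv:2412.07952 — 2 statements merged into one kernel-verified Lean document; each statement's English description precedes it below -/
import Mathlib

section
/- For any real k > -1, the k-th moment of the area of a triangle with i.i.d. uniform vertices in a fixed triangle of unit area equals (48/((1+k)(2+k)^2(3+k))) · ∫₀¹∫₀¹ (1-x)^{2+k} (x^{2+k} - y^{2+k})/(x - y) dx dy. -/
open MeasureTheory

theorem intervalIntegrable_abs_rpow {k : ℝ} (hk : -1 < k) (a b : ℝ) :
    IntervalIntegrable (fun z : ℝ => |z| ^ k) volume a b := by
  have key : ∀ c : ℝ, IntervalIntegrable (fun z : ℝ => |z| ^ k) volume 0 c := by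
    have pos : ∀ c : ℝ, 0 ≤ c → IntervalIntegrable (fun z : ℝ => |z| ^ k) volume 0 c := by
      intro c hc
      refine (intervalIntegral.intervalIntegrable_rpow' (a := 0) (b := c) hk).congr ?_
      intro z hz
      rw [Set.uIoc_of_le hc] at hz
      simp only [abs_of_pos hz.1]
    intro c
    rcases le_total 0 c with hc | hc
    · exact pos c hc
    · have h := (pos (-c) (by linarith)).comp_sub_left 0
      simpa using h
  exact (key a).symm.trans (key b)

theorem integral_abs_rpow {k : ℝ} (hk : -1 < k) (a b : ℝ) :
    ∫ z in a..b, |z| ^ k = (|b| ^ k * b - |a| ^ k * a) / (k + 1) := by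
  have hk1 : k + 1 ≠ 0 := by linarith
  have pos : ∀ c : ℝ, 0 ≤ c → ∫ z in (0 : ℝ)..c, |z| ^ k = |c| ^ k * c / (k + 1) := by
    intro c hc
    have : ∫ z in (0 : ℝ)..c, |z| ^ k = ∫ z in (0 : ℝ)..c, z ^ k := by
      refine intervalIntegral.integral_congr fun z hz => ?_
      rw [Set.uIcc_of_le hc] at hz
      simp only [abs_of_nonneg hz.1]
    rw [this, integral_rpow (Or.inl hk), Real.zero_rpow hk1, abs_of_nonneg hc, sub_zero,
      Real.rpow_add_one' hc hk1]
  have key : ∀ c : ℝ, ∫ z in (0 : ℝ)..c, |z| ^ k = |c| ^ k * c / (k + 1) := by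
    intro c
    rcases le_total 0 c with hc | hc
    · exact pos c hc
    · have h := pos (-c) (by linarith)
      have h2 := intervalIntegral.integral_comp_neg (a := c) (b := 0) (fun z : ℝ => |z| ^ k)
      simp only [abs_neg, neg_zero] at h2 h
      rw [intervalIntegral.integral_symm, h2, h]
      ring
  rw [← intervalIntegral.integral_interval_sub_left (intervalIntegrable_abs_rpow hk 0 b)
    (intervalIntegrable_abs_rpow hk 0 a), key, key]
  ring

theorem continuous_abs_rpow_mul_self {k : ℝ} (hk : -1 < k) :
    Continuous (fun z : ℝ => |z| ^ k * z) := by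
  have h : ContDiff ℝ 1 (fun z : ℝ => ‖z‖ ^ (k + 2)) := contDiff_norm_rpow (by linarith)
  have h2 : (fun z : ℝ => |z| ^ k * z) = fun z => (k + 2)⁻¹ * deriv (fun z : ℝ => ‖z‖ ^ (k + 2)) z := by
    funext z
    have hd : deriv (fun z : ℝ => ‖z‖ ^ (k + 2)) z = _ :=
      (hasDerivAt_abs_rpow z (p := k + 2) (by linarith)).deriv
    rw [hd]
    have : k + 2 ≠ 0 := by linarith
    rw [add_sub_cancel_right]
    field_simp
  rw [h2]
  exact continuous_const.mul (h.continuous_deriv le_rfl)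

theorem integral_abs_rpow_mul_self {k : ℝ} (hk : -1 < k) (a b : ℝ) :
    ∫ z in a..b, |z| ^ k * z = (|b| ^ (k + 2) - |a| ^ (k + 2)) / (k + 2) := by
  have h2 : k + 2 ≠ 0 := by linarith
  have := intervalIntegral.integral_eq_sub_of_hasDerivAt (a := a) (b := b)
    (f := fun z : ℝ => |z| ^ (k + 2) / (k + 2)) (f' := fun z : ℝ => |z| ^ k * z)
    (fun z _ => by
      have h := (hasDerivAt_abs_rpow z (p := k + 2) (by linarith)).div_const (k + 2)
      rw [add_sub_cancel_right, mul_assoc, mul_div_cancel_left₀ _ h2] at h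
      exact h)
    ((continuous_abs_rpow_mul_self hk).intervalIntegrable _ _)
  rw [this]
  ring

/-- The integral of `|c + d y| ^ k` over `[0, m]`, as a lower integral. -/
theorem lintegral_Icc_abs_affine_rpow {k : ℝ} (hk : -1 < k) {d : ℝ} (hd : d ≠ 0) (c : ℝ) {m : ℝ}
    (hm : 0 ≤ m) :
    0 ≤ (|c + d * m| ^ k * (c + d * m) - |c| ^ k * c) / (d * (k + 1)) ∧
    ∫⁻ y in Set.Icc 0 m, ENNReal.ofReal (|c + d * y| ^ k) =
      ENNReal.ofReal ((|c + d * m| ^ k * (c + d * m) - |c| ^ k * c) / (d * (k + 1))) := by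
  have hval : ∫ y in (0 : ℝ)..m, |c + d * y| ^ k =
      (|c + d * m| ^ k * (c + d * m) - |c| ^ k * c) / (d * (k + 1)) := by
    rw [intervalIntegral.integral_comp_add_mul (fun z : ℝ => |z| ^ k) hd c,
      integral_abs_rpow hk, smul_eq_mul, mul_zero, add_zero]
    have : k + 1 ≠ 0 := by linarith
    field_simp
  have hint : IntervalIntegrable (fun y => |c + d * y| ^ k) volume 0 m := by
    have h := ((intervalIntegrable_abs_rpow hk (c + d * 0) (c + d * m)).comp_add_left c).comp_mul_left
      (c := d)
    convert h using 1 <;> field_simp <;> ring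
  constructor
  · rw [← hval]
    exact intervalIntegral.integral_nonneg hm fun y _ => by positivity
  · rw [← hval, intervalIntegral.integral_of_le hm, ← restrict_Ioc_eq_restrict_Icc,
      ofReal_integral_eq_lintegral_ofReal]
    · exact (intervalIntegrable_iff_integrableOn_Ioc_of_le hm).1 hint
    · exact Filter.Eventually.of_forall fun y => by positivity

/-- The triangle with vertices `(0, 0)`, `(1, 0)`, `(0, 1)`. -/
def unitTriangle : Set (ℝ × ℝ) := {p | 0 ≤ p.1 ∧ 0 ≤ p.2 ∧ p.1 + p.2 ≤ 1}

theorem isClosed_unitTriangle : IsClosed unitTriangle :=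
  (isClosed_le continuous_const continuous_fst).inter
    ((isClosed_le continuous_const continuous_snd).inter
      (isClosed_le (continuous_fst.add continuous_snd) continuous_const))

theorem measurableSet_unitTriangle : MeasurableSet unitTriangle :=
  isClosed_unitTriangle.measurableSet

theorem setLIntegral_unitTriangle {f : ℝ × ℝ → ENNReal} (hf : Measurable f) :
    ∫⁻ p in unitTriangle, f p = ∫⁻ x in Set.Icc (0 : ℝ) 1, ∫⁻ y in Set.Icc 0 (1 - x), f (x, y) := by
  rw [← lintegral_indicator measurableSet_unitTriangle, Measure.volume_eq_prod,
    lintegral_prod _ (hf.indicator measurableSet_unitTriangle).aemeasurable,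
    ← lintegral_indicator measurableSet_Icc]
  refine lintegral_congr fun x => ?_
  by_cases hx : x ∈ Set.Icc (0 : ℝ) 1
  · rw [Set.indicator_of_mem hx, ← lintegral_indicator measurableSet_Icc]
    refine lintegral_congr fun y => ?_
    have : (x, y) ∈ unitTriangle ↔ y ∈ Set.Icc 0 (1 - x) := by
      simp only [unitTriangle, Set.mem_ofPred_eq, Set.mem_Icc]
      constructor
      · rintro ⟨-, h1, h2⟩
        exact ⟨h1, by linarith⟩
      · rintro ⟨h1, h2⟩
        exact ⟨hx.1, h1, by linarith⟩
    by_cases hy : y ∈ Set.Icc 0 (1 - x)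
    · rw [Set.indicator_of_mem hy, Set.indicator_of_mem (this.2 hy)]
    · rw [Set.indicator_of_notMem hy, Set.indicator_of_notMem (fun h => hy (this.1 h))]
  · rw [Set.indicator_of_notMem hx]
    refine (lintegral_congr fun y => ?_).trans lintegral_zero
    refine Set.indicator_of_notMem (fun h => hx ⟨h.1, ?_⟩) _
    have h1 := h.2.1
    have h2 := h.2.2
    simp only at h1 h2
    linarith

/-- The integral over the unit triangle of `|L| ^ k`, where `L` is the affine function with values
`α`, `β`, `γ` at the vertices. -/
theorem lintegral_unitTriangle_abs_affine_rpow {k : ℝ} (hk : -1 < k) {α β γ : ℝ} (hαβ : α ≠ β)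
    (hαγ : α ≠ γ) (hβγ : β ≠ γ) :
    0 ≤ (|α| ^ (k + 2) / ((α - β) * (α - γ)) + |β| ^ (k + 2) / ((β - α) * (β - γ)) +
        |γ| ^ (k + 2) / ((γ - α) * (γ - β))) / ((k + 1) * (k + 2)) ∧
    ∫⁻ p in unitTriangle, ENNReal.ofReal (|α + (β - α) * p.1 + (γ - α) * p.2| ^ k) =
      ENNReal.ofReal ((|α| ^ (k + 2) / ((α - β) * (α - γ)) + |β| ^ (k + 2) / ((β - α) * (β - γ)) +
        |γ| ^ (k + 2) / ((γ - α) * (γ - β))) / ((k + 1) * (k + 2))) := by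
  have h1 : k + 1 ≠ 0 := by linarith
  have h2 : k + 2 ≠ 0 := by linarith
  have hd : γ - α ≠ 0 := sub_ne_zero.2 hαγ.symm
  have hba : β - α ≠ 0 := sub_ne_zero.2 hαβ.symm
  have hbg : β - γ ≠ 0 := sub_ne_zero.2 hβγ
  have hab : α - β ≠ 0 := sub_ne_zero.2 hαβ
  have hag : α - γ ≠ 0 := sub_ne_zero.2 hαγ
  have hgb : γ - β ≠ 0 := sub_ne_zero.2 hβγ.symm
  set g : ℝ → ℝ := fun x => (|γ + (β - γ) * x| ^ k * (γ + (β - γ) * x) -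
    |α + (β - α) * x| ^ k * (α + (β - α) * x)) / ((γ - α) * (k + 1)) with hg
  have hin : ∀ x ∈ Set.Icc (0 : ℝ) 1, 0 ≤ g x ∧
      ∫⁻ y in Set.Icc 0 (1 - x), ENNReal.ofReal (|α + (β - α) * x + (γ - α) * y| ^ k) =
        ENNReal.ofReal (g x) := by
    intro x hx
    have h := lintegral_Icc_abs_affine_rpow hk hd (α + (β - α) * x) (sub_nonneg.2 hx.2)
    rwa [show α + (β - α) * x + (γ - α) * (1 - x) = γ + (β - γ) * x by ring] at h
  have hGc := continuous_abs_rpow_mul_self hk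
  have hG1 : ∀ c d : ℝ, Continuous fun x => |c + d * x| ^ k * (c + d * x) := fun c d =>
    hGc.comp (by fun_prop : Continuous fun x : ℝ => c + d * x)
  have hgc : Continuous g := ((hG1 _ _).sub (hG1 _ _)).div_const _
  have hval : ∫ x in Set.Icc (0 : ℝ) 1, g x =
      (|α| ^ (k + 2) / ((α - β) * (α - γ)) + |β| ^ (k + 2) / ((β - α) * (β - γ)) +
        |γ| ^ (k + 2) / ((γ - α) * (γ - β))) / ((k + 1) * (k + 2)) := by
    rw [integral_Icc_eq_integral_Ioc, ← intervalIntegral.integral_of_le zero_le_one]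
    simp only [hg]
    rw [intervalIntegral.integral_div, intervalIntegral.integral_sub
      ((hG1 _ _).intervalIntegrable _ _) ((hG1 _ _).intervalIntegrable _ _),
      intervalIntegral.integral_comp_add_mul (fun z : ℝ => |z| ^ k * z) hbg,
      intervalIntegral.integral_comp_add_mul (fun z : ℝ => |z| ^ k * z) hba,
      integral_abs_rpow_mul_self hk, integral_abs_rpow_mul_self hk]
    simp only [mul_zero, add_zero, mul_one, smul_eq_mul, add_sub_cancel]
    rw [← neg_sub β α, ← neg_sub γ α, ← neg_sub β γ]
    field_simp
    ring
  rw [← hval]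
  refine ⟨setIntegral_nonneg measurableSet_Icc fun x hx => (hin x hx).1, ?_⟩
  rw [setLIntegral_unitTriangle (by fun_prop), setLIntegral_congr_fun measurableSet_Icc
    (fun x hx => (hin x hx).2), ← ofReal_integral_eq_lintegral_ofReal]
  · exact hgc.continuousOn.integrableOn_compact isCompact_Icc
  · exact (ae_restrict_iff' measurableSet_Icc).2 (Filter.Eventually.of_forall fun x hx =>
      (hin x hx).1)

theorem lintegral_Icc_Icc_abs_sub_rpow {p : ℝ} (hp : -1 < p) {m : ℝ} (hm : 0 ≤ m) :
    ∫⁻ x in Set.Icc 0 m, ∫⁻ y in Set.Icc 0 m, ENNReal.ofReal (|x - y| ^ p) =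
      ENNReal.ofReal (2 * m ^ (p + 2) / ((p + 1) * (p + 2))) := by
  have h1 : p + 1 ≠ 0 := by linarith
  have h2 : p + 2 ≠ 0 := by linarith
  set g : ℝ → ℝ := fun x => (|x - m| ^ p * (x - m) - |x| ^ p * x) / -(p + 1) with hg
  have hin : ∀ x, 0 ≤ g x ∧
      ∫⁻ y in Set.Icc 0 m, ENNReal.ofReal (|x - y| ^ p) = ENNReal.ofReal (g x) := by
    intro x
    have h := lintegral_Icc_abs_affine_rpow hp (neg_ne_zero.2 one_ne_zero) x hm
    simpa [← sub_eq_add_neg, hg] using h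
  have hGc := continuous_abs_rpow_mul_self hp
  have hG1 : Continuous fun x => |x - m| ^ p * (x - m) :=
    hGc.comp (by fun_prop : Continuous fun x : ℝ => x - m)
  have hgc : Continuous g := (hG1.sub hGc).div_const _
  rw [setLIntegral_congr_fun measurableSet_Icc (fun x _ => (hin x).2),
    ← ofReal_integral_eq_lintegral_ofReal]
  · congr 1
    rw [integral_Icc_eq_integral_Ioc, ← intervalIntegral.integral_of_le hm]
    simp only [hg]
    rw [intervalIntegral.integral_div, intervalIntegral.integral_sub
      (hG1.intervalIntegrable _ _) (hGc.intervalIntegrable _ _),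
      intervalIntegral.integral_comp_sub_right (fun z : ℝ => |z| ^ p * z) m,
      integral_abs_rpow_mul_self hp, integral_abs_rpow_mul_self hp]
    simp only [zero_sub, sub_self, abs_neg, abs_zero, Real.zero_rpow h2, abs_of_nonneg hm]
    field_simp
    ring
  · exact hgc.continuousOn.integrableOn_compact isCompact_Icc
  · exact Filter.Eventually.of_forall fun x => (hin x).1

theorem lintegral_comp_add_mul (f : ℝ → ENNReal) (y : ℝ) {c : ℝ} (hc : c ≠ 0) :
    ∫⁻ t, f t = ∫⁻ b, ENNReal.ofReal |c| * f (y + b * c) := by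
  have himg : (fun b : ℝ => y + b * c) '' Set.univ = Set.univ := by
    rw [Set.image_univ]
    exact Set.range_eq_univ.2 fun t => ⟨(t - y) / c, by field_simp; ring⟩
  have h := lintegral_image_eq_lintegral_abs_deriv_mul (s := Set.univ)
    (f := fun b : ℝ => y + b * c) (f' := fun _ => c) MeasurableSet.univ
    (fun b _ => by simpa using (hasDerivAt_id b).mul_const c)
    (fun b _ b' _ hb => by simpa [hc] using hb) f
  rw [himg] at h
  simpa using h

/-- Change of variables parametrizing two points of the plane by the line `Y = a - b X` through
them and their first coordinates. -/
theorem lintegral_line_coordinates {F : ℝ → ℝ → ℝ → ℝ → ENNReal}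
    (hF : Measurable fun q : ℝ × ℝ × ℝ × ℝ => F q.1 q.2.1 q.2.2.1 q.2.2.2) :
    ∫⁻ x, ∫⁻ y, ∫⁻ x', ∫⁻ y', F x y x' y' =
      ∫⁻ a, ∫⁻ b, ∫⁻ x, ∫⁻ x', ENNReal.ofReal |x - x'| * F x (a - b * x) x' (a - b * x') := by
  have hF' : ∀ {β : Type} [MeasurableSpace β] {f₁ f₂ f₃ f₄ : β → ℝ}, Measurable f₁ →
      Measurable f₂ → Measurable f₃ → Measurable f₄ →
      Measurable fun q => F (f₁ q) (f₂ q) (f₃ q) (f₄ q) := fun h₁ h₂ h₃ h₄ =>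
    hF.comp (h₁.prodMk (h₂.prodMk (h₃.prodMk h₄)))
  set G : ℝ → ℝ → ℝ → ℝ → ENNReal := fun a b x x' =>
    ENNReal.ofReal |x - x'| * F x (a - b * x) x' (a - b * x') with hG
  have hG' : ∀ {β : Type} [MeasurableSpace β] {f₁ f₂ f₃ f₄ : β → ℝ}, Measurable f₁ →
      Measurable f₂ → Measurable f₃ → Measurable f₄ →
      Measurable fun q => G (f₁ q) (f₂ q) (f₃ q) (f₄ q) := by
    intro β _ f₁ f₂ f₃ f₄ h₁ h₂ h₃ h₄
    exact Measurable.mul (by fun_prop)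
      (hF' h₃ (by fun_prop) h₄ (by fun_prop))
  calc ∫⁻ x, ∫⁻ y, ∫⁻ x', ∫⁻ y', F x y x' y'
      = ∫⁻ x, ∫⁻ x', ∫⁻ y, ∫⁻ y', F x y x' y' := by
        refine lintegral_congr fun x => lintegral_lintegral_swap ?_
        refine (Measurable.lintegral_prod_right' (f := fun q : (ℝ × ℝ) × ℝ =>
          F x q.1.1 q.1.2 q.2) ?_).aemeasurable
        exact hF' (by fun_prop) (by fun_prop) (by fun_prop) (by fun_prop)
    _ = ∫⁻ x, ∫⁻ x', ∫⁻ a, ∫⁻ b, G a b x x' := by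
        refine lintegral_congr fun x => lintegral_congr_ae ?_
        filter_upwards [Measure.ae_ne volume x] with x' hx'
        have hc : x - x' ≠ 0 := sub_ne_zero.2 hx'.symm
        calc ∫⁻ y, ∫⁻ y', F x y x' y'
            = ∫⁻ y, ∫⁻ b, ENNReal.ofReal |x - x'| * F x y x' (y + b * (x - x')) :=
              lintegral_congr fun y => lintegral_comp_add_mul _ y hc
          _ = ∫⁻ b, ∫⁻ y, ENNReal.ofReal |x - x'| * F x y x' (y + b * (x - x')) := by
              refine lintegral_lintegral_swap (Measurable.aemeasurable ?_)
              exact Measurable.mul (by fun_prop)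
                (hF' (by fun_prop) (by fun_prop) (by fun_prop) (by fun_prop))
          _ = ∫⁻ b, ∫⁻ a, G a b x x' := by
              refine lintegral_congr fun b => ?_
              rw [← lintegral_sub_right_eq_self _ (b * x)]
              refine lintegral_congr fun a => ?_
              simp only [hG]
              congr 2
              ring
          _ = ∫⁻ a, ∫⁻ b, G a b x x' := by
              refine lintegral_lintegral_swap (Measurable.aemeasurable ?_)
              exact hG' (by fun_prop) (by fun_prop) (by fun_prop) (by fun_prop)
    _ = ∫⁻ x, ∫⁻ a, ∫⁻ x', ∫⁻ b, G a b x x' := by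
        refine lintegral_congr fun x => lintegral_lintegral_swap ?_
        refine (Measurable.lintegral_prod_right' (f := fun q : (ℝ × ℝ) × ℝ =>
          G q.1.2 q.2 x q.1.1) ?_).aemeasurable
        exact hG' (by fun_prop) (by fun_prop) (by fun_prop) (by fun_prop)
    _ = ∫⁻ a, ∫⁻ x, ∫⁻ x', ∫⁻ b, G a b x x' := by
        refine lintegral_lintegral_swap ?_
        refine (Measurable.lintegral_prod_right' (f := fun q : (ℝ × ℝ) × ℝ =>
          ∫⁻ b, G q.1.2 b q.1.1 q.2) ?_).aemeasurable
        refine Measurable.lintegral_prod_right' (f := fun q : ((ℝ × ℝ) × ℝ) × ℝ =>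
          G q.1.1.2 q.2 q.1.1.1 q.1.2) ?_
        exact hG' (by fun_prop) (by fun_prop) (by fun_prop) (by fun_prop)
    _ = ∫⁻ a, ∫⁻ x, ∫⁻ b, ∫⁻ x', G a b x x' := by
        refine lintegral_congr fun a => lintegral_congr fun x => lintegral_lintegral_swap ?_
        refine Measurable.aemeasurable ?_
        exact hG' (by fun_prop) (by fun_prop) (by fun_prop) (by fun_prop)
    _ = ∫⁻ a, ∫⁻ b, ∫⁻ x, ∫⁻ x', G a b x x' := by
        refine lintegral_congr fun a => lintegral_lintegral_swap ?_
        refine (Measurable.lintegral_prod_right' (f := fun q : (ℝ × ℝ) × ℝ =>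
          G a q.1.2 q.1.1 q.2) ?_).aemeasurable
        exact hG' (by fun_prop) (by fun_prop) (by fun_prop) (by fun_prop)

/-- Twice the signed area of the triangle `p q r`. -/
def tripleDet (p q r : ℝ × ℝ) : ℝ :=
  (p.1 * q.2 - q.1 * p.2) - r.1 * (q.2 - p.2) + r.2 * (q.1 - p.1)

/-- Pairs of points whose line separates the origin from `(1, 0)` and from `(0, 1)`. -/
def originSeparated : Set ((ℝ × ℝ) × (ℝ × ℝ)) :=
  {w | tripleDet w.1 w.2 (0, 0) * tripleDet w.1 w.2 (1, 0) < 0 ∧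
    tripleDet w.1 w.2 (0, 0) * tripleDet w.1 w.2 (0, 1) < 0}

/-- The integral of the `k`-th power of `|tripleDet p q ·|` over the unit triangle. -/
noncomputable def innerMoment (k : ℝ) (w : (ℝ × ℝ) × (ℝ × ℝ)) : ENNReal :=
  ∫⁻ r in unitTriangle, ENNReal.ofReal (|tripleDet w.1 w.2 r| ^ k)

theorem measurable_innerMoment (k : ℝ) : Measurable (innerMoment k) := by
  refine Measurable.lintegral_prod_right' (f := fun q : ((ℝ × ℝ) × (ℝ × ℝ)) × (ℝ × ℝ) =>
    ENNReal.ofReal (|tripleDet q.1.1 q.1.2 q.2| ^ k)) ?_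
  unfold tripleDet
  fun_prop

theorem measurableSet_originSeparated : MeasurableSet originSeparated := by
  have h : ∀ r, Measurable fun w : (ℝ × ℝ) × (ℝ × ℝ) => tripleDet w.1 w.2 r := fun r => by
    unfold tripleDet
    fun_prop
  exact (measurableSet_lt ((h (0, 0)).mul (h (1, 0))) measurable_const).inter
    (measurableSet_lt ((h (0, 0)).mul (h (0, 1))) measurable_const)

theorem tripleDet_line (a b x x' : ℝ) (r : ℝ × ℝ) :
    tripleDet (x, a - b * x) (x', a - b * x') r = (x - x') * (a - b * r.1 - r.2) := by
  simp only [tripleDet]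
  ring

theorem mem_originSeparated_line {a b x x' : ℝ} (h : x ≠ x') :
    ((x, a - b * x), (x', a - b * x')) ∈ originSeparated ↔ a ∈ Set.Ioo (0 : ℝ) 1 ∧ b ∈ Set.Ioi a := by
  have hpos : 0 < (x - x') ^ 2 := by
    have := sub_ne_zero.2 h
    positivity
  simp only [originSeparated, Set.mem_ofPred_eq, tripleDet_line, Set.mem_Ioo, Set.mem_Ioi]
  have hsign : ∀ c, (x - x') * (a - b * 0 - 0) * ((x - x') * c) < 0 ↔ a * c < 0 := fun c => by
    rw [show (x - x') * (a - b * 0 - 0) * ((x - x') * c) = (x - x') ^ 2 * (a * c) by ring]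
    exact ⟨fun h => by_contra fun h' => absurd h (mul_nonneg hpos.le (not_lt.1 h')).not_gt,
      fun h => mul_neg_of_pos_of_neg hpos h⟩
  rw [hsign, hsign, mul_neg_iff, mul_neg_iff]
  constructor
  · rintro ⟨h1 | h1, h2 | h2⟩ <;> refine ⟨⟨?_, ?_⟩, ?_⟩ <;> linarith [h1.1, h1.2, h2.1, h2.2]
  · rintro ⟨⟨h1, h2⟩, h3⟩
    exact ⟨Or.inl ⟨h1, by linarith⟩, Or.inl ⟨h1, by linarith⟩⟩

theorem mem_unitTriangle_line {a b : ℝ} (ha : a ∈ Set.Ioo (0 : ℝ) 1) (hb : b ∈ Set.Ioi a) (x : ℝ) :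
    (x, a - b * x) ∈ unitTriangle ↔ x ∈ Set.Icc 0 (a / b) := by
  have hb0 : 0 < b := ha.1.trans hb
  have hba : a < b := hb
  simp only [unitTriangle, Set.mem_ofPred_eq, Set.mem_Icc, le_div_iff₀ hb0]
  constructor
  · rintro ⟨h1, h2, -⟩
    exact ⟨h1, by linarith⟩
  · rintro ⟨h1, h2⟩
    refine ⟨h1, by linarith, ?_⟩
    rcases le_total b 1 with h | h
    · have : x ≤ 1 := by nlinarith
      nlinarith [ha.2]
    · nlinarith [ha.2]

theorem lintegral_originSeparated_eq_line {k : ℝ} (hk : -1 < k) :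
    ∫⁻ p in unitTriangle, ∫⁻ q in unitTriangle, originSeparated.indicator (innerMoment k) (p, q) =
      ∫⁻ a in Set.Ioo (0 : ℝ) 1, ∫⁻ b in Set.Ioi a,
        ENNReal.ofReal (2 * (a / b) ^ (k + 3) / ((k + 2) * (k + 3))) *
          ∫⁻ r in unitTriangle, ENNReal.ofReal (|a - b * r.1 - r.2| ^ k) := by
  set F : (ℝ × ℝ) × (ℝ × ℝ) → ENNReal :=
    ((unitTriangle ×ˢ unitTriangle) ∩ originSeparated).indicator (innerMoment k) with hFdef
  have hF : Measurable F := (measurable_innerMoment k).indicator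
    ((measurableSet_unitTriangle.prod measurableSet_unitTriangle).inter
      measurableSet_originSeparated)
  have hstart : ∫⁻ p in unitTriangle, ∫⁻ q in unitTriangle,
      originSeparated.indicator (innerMoment k) (p, q) =
      ∫⁻ x, ∫⁻ y, ∫⁻ x', ∫⁻ y', F ((x, y), (x', y')) := by
    have h1 : ∀ p, ∫⁻ x', ∫⁻ y', F (p, (x', y')) = ∫⁻ q, F (p, q) := fun p => by
      rw [Measure.volume_eq_prod, lintegral_prod]
      exact (hF.comp (by fun_prop : Measurable fun q : ℝ × ℝ => (p, q))).aemeasurable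
    simp only [h1]
    rw [← lintegral_prod (μ := volume) (ν := volume) (fun p : ℝ × ℝ => ∫⁻ q, F (p, q))
      hF.lintegral_prod_right'.aemeasurable, ← Measure.volume_eq_prod,
      ← lintegral_indicator measurableSet_unitTriangle]
    refine lintegral_congr fun p => ?_
    by_cases hp : p ∈ unitTriangle
    · rw [Set.indicator_of_mem hp, ← lintegral_indicator measurableSet_unitTriangle]
      refine lintegral_congr fun q => ?_
      by_cases hq : q ∈ unitTriangle <;> by_cases hs : (p, q) ∈ originSeparated <;>
        simp [hFdef, hp, hq, hs]
    · rw [Set.indicator_of_notMem hp]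
      simp [hFdef, hp]
  rw [hstart, lintegral_line_coordinates (F := fun x y x' y' => F ((x, y), (x', y')))
    (hF.comp (by fun_prop : Measurable fun q : ℝ × ℝ × ℝ × ℝ => ((q.1, q.2.1), (q.2.2.1, q.2.2.2)))),
    ← lintegral_indicator measurableSet_Ioo]
  refine lintegral_congr fun a => ?_
  by_cases ha : a ∈ Set.Ioo (0 : ℝ) 1
  swap
  · rw [Set.indicator_of_notMem ha]
    have : ∀ b x x', ENNReal.ofReal |x - x'| * F ((x, a - b * x), (x', a - b * x')) = 0 := by
      intro b x x'
      by_cases h : x = x'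
      · simp [h]
      · have : ((x, a - b * x), (x', a - b * x')) ∉ originSeparated := fun hm =>
          ha ((mem_originSeparated_line h).1 hm).1
        rw [hFdef, Set.indicator_of_notMem (fun hm => this hm.2), mul_zero]
    simp [this]
  rw [Set.indicator_of_mem ha, ← lintegral_indicator measurableSet_Ioi]
  refine lintegral_congr fun b => ?_
  by_cases hb : b ∈ Set.Ioi a
  swap
  · rw [Set.indicator_of_notMem hb]
    have : ∀ x x', ENNReal.ofReal |x - x'| * F ((x, a - b * x), (x', a - b * x')) = 0 := by
      intro x x'
      by_cases h : x = x'
      · simp [h]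
      · have : ((x, a - b * x), (x', a - b * x')) ∉ originSeparated := fun hm =>
          hb ((mem_originSeparated_line h).1 hm).2
        rw [hFdef, Set.indicator_of_notMem (fun hm => this hm.2), mul_zero]
    simp [this]
  rw [Set.indicator_of_mem hb]
  set Ψ := ∫⁻ r in unitTriangle, ENNReal.ofReal (|a - b * r.1 - r.2| ^ k) with hΨ
  have hm : 0 ≤ a / b := (div_pos ha.1 (ha.1.trans hb)).le
  have hk1 : k + 1 ≠ 0 := by linarith
  have hpt : ∀ x x', ENNReal.ofReal |x - x'| * F ((x, a - b * x), (x', a - b * x')) =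
      (Set.Icc 0 (a / b)).indicator (fun x => (Set.Icc 0 (a / b)).indicator
        (fun x' => ENNReal.ofReal (|x - x'| ^ (k + 1)) * Ψ) x') x := by
    intro x x'
    by_cases h : x = x'
    · subst h
      simp [Real.zero_rpow hk1, Set.indicator]
    · have hpos : 0 < |x - x'| := abs_pos.2 (sub_ne_zero.2 h)
      have hmem := (mem_originSeparated_line (a := a) (b := b) h).2 ⟨ha, hb⟩
      have hin : innerMoment k ((x, a - b * x), (x', a - b * x')) =
          ENNReal.ofReal (|x - x'| ^ k) * Ψ := by
        rw [innerMoment, hΨ, ← lintegral_const_mul _ (by fun_prop)]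
        refine lintegral_congr fun r => ?_
        rw [← ENNReal.ofReal_mul (by positivity)]
        simp only [tripleDet_line]
        rw [abs_mul, Real.mul_rpow (abs_nonneg _) (abs_nonneg _)]
      have hx := mem_unitTriangle_line ha hb x
      have hx' := mem_unitTriangle_line ha hb x'
      simp only [hFdef, Set.indicator, Set.mem_inter_iff, Set.mem_prod, hx, hx', hmem, and_true, hin]
      by_cases h1 : x ∈ Set.Icc 0 (a / b)
      · by_cases h2 : x' ∈ Set.Icc 0 (a / b)
        · simp only [h1, h2, and_self, if_true]
          rw [← mul_assoc, ← ENNReal.ofReal_mul hpos.le, Real.rpow_add_one hpos.ne', mul_comm (|x - x'|)]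
        · simp [h1, h2]
      · simp [h1]
  have hval : ∫⁻ x, ∫⁻ x', (Set.Icc 0 (a / b)).indicator (fun x => (Set.Icc 0 (a / b)).indicator
        (fun x' => ENNReal.ofReal (|x - x'| ^ (k + 1)) * Ψ) x') x =
      ∫⁻ x in Set.Icc 0 (a / b), ∫⁻ x' in Set.Icc 0 (a / b),
        ENNReal.ofReal (|x - x'| ^ (k + 1)) * Ψ := by
    rw [← lintegral_indicator measurableSet_Icc]
    refine lintegral_congr fun x => ?_
    by_cases h1 : x ∈ Set.Icc 0 (a / b)
    · simp only [Set.indicator_of_mem h1]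
      rw [lintegral_indicator measurableSet_Icc]
    · simp [Set.indicator_of_notMem h1]
  simp only [hpt]
  rw [hval]
  have hmeas : Measurable fun q : ℝ × ℝ => ENNReal.ofReal (|q.1 - q.2| ^ (k + 1)) := by fun_prop
  have hinner : ∀ x, ∫⁻ x' in Set.Icc 0 (a / b), ENNReal.ofReal (|x - x'| ^ (k + 1)) * Ψ =
      (∫⁻ x' in Set.Icc 0 (a / b), ENNReal.ofReal (|x - x'| ^ (k + 1))) * Ψ := fun x =>
    lintegral_mul_const Ψ (by fun_prop)
  simp only [hinner]
  rw [lintegral_mul_const Ψ hmeas.lintegral_prod_right',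
    lintegral_Icc_Icc_abs_sub_rpow (by linarith) hm]
  congr 3
  · ring_nf
  · ring_nf

/-- The density, in terms of the intercepts `s`, `t` of the secant line through two of the points,
of the contribution of one separated vertex. -/
noncomputable def secantKernel (p s t : ℝ) : ℝ :=
  s ^ p * t ^ p + (s * t ^ p * (1 - s) ^ p - t * s ^ p * (1 - t) ^ p) / (t - s)

theorem secantKernel_spec {k : ℝ} (hk : -1 < k) {s t : ℝ} (hs : s ∈ Set.Ioo (0 : ℝ) 1)
    (ht : t ∈ Set.Ioo (0 : ℝ) 1) (hst : s ≠ t) :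
    0 ≤ secantKernel (k + 2) s t ∧
    ENNReal.ofReal |-t / s ^ 2| * (ENNReal.ofReal (2 * s ^ (k + 3) / ((k + 2) * (k + 3))) *
      ∫⁻ r in unitTriangle, ENNReal.ofReal (|t - t / s * r.1 - r.2| ^ k)) =
    ENNReal.ofReal (2 / ((k + 1) * (k + 2) ^ 2 * (k + 3)) * secantKernel (k + 2) s t) := by
  have h1 : 0 < k + 1 := by linarith
  have h2 : 0 < k + 2 := by linarith
  have h3 : 0 < k + 3 := by linarith
  have hs0 := hs.1
  have ht0 := ht.1
  have hs1 : 0 < 1 - s := sub_pos.2 hs.2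
  have ht1 : 0 < 1 - t := sub_pos.2 ht.2
  have hts : t - s ≠ 0 := sub_ne_zero.2 hst.symm
  have hb : 0 < t / s := div_pos ht0 hs0
  have hbne : t / s ≠ 1 := by
    rw [Ne, div_eq_one_iff_eq hs0.ne']
    exact hst.symm
  obtain ⟨hV0, hV⟩ := lintegral_unitTriangle_abs_affine_rpow hk (α := t) (β := t - t / s)
    (γ := t - 1) (by linarith) (by linarith) (fun h => hbne (by linarith))
  set V := (|t| ^ (k + 2) / ((t - (t - t / s)) * (t - (t - 1))) +
    |t - t / s| ^ (k + 2) / ((t - t / s - t) * (t - t / s - (t - 1))) +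
    |t - 1| ^ (k + 2) / ((t - 1 - t) * (t - 1 - (t - t / s)))) / ((k + 1) * (k + 2)) with hVdef
  have habs : |-t / s ^ 2| = t / s ^ 2 := by
    rw [abs_div, abs_neg, abs_of_pos ht0, abs_of_pos (by positivity)]
  have hid : t / s ^ 2 * (2 * s ^ (k + 3) / ((k + 2) * (k + 3)) * V) =
      2 / ((k + 1) * (k + 2) ^ 2 * (k + 3)) * secantKernel (k + 2) s t := by
    have e1 : |t - t / s| ^ (k + 2) = t ^ (k + 2) * (1 - s) ^ (k + 2) / s ^ (k + 2) := by
      rw [show t - t / s = -(t * (1 - s) / s) by field_simp; ring, abs_neg,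
        abs_of_pos (by positivity), Real.div_rpow (by positivity) hs0.le,
        Real.mul_rpow ht0.le hs1.le]
    have e2 : |t - 1| ^ (k + 2) = (1 - t) ^ (k + 2) := by
      rw [abs_sub_comm, abs_of_pos ht1]
    have e3 : s ^ (k + 3) = s ^ (k + 2) * s := by
      rw [← Real.rpow_add_one hs0.ne']
      ring_nf
    have hS : 0 < s ^ (k + 2) := Real.rpow_pos_of_pos hs0 _
    rw [hVdef, e1, e2, e3, abs_of_pos ht0, secantKernel]
    rw [show t - (t - t / s) = t / s by ring, show t - (t - 1) = 1 by ring,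
      show t - t / s - t = -(t / s) by ring,
      show t - t / s - (t - 1) = -((t - s) / s) by field_simp; ring,
      show t - 1 - t = -1 by ring,
      show t - 1 - (t - t / s) = (t - s) / s by field_simp; ring]
    generalize s ^ (k + 2) = S at *
    generalize t ^ (k + 2) = T at *
    generalize (1 - s) ^ (k + 2) = S' at *
    generalize (1 - t) ^ (k + 2) = T' at *
    field_simp
    ring
  constructor
  · have hc : 0 < 2 / ((k + 1) * (k + 2) ^ 2 * (k + 3)) := by positivity
    refine nonneg_of_mul_nonneg_right (a := 2 / ((k + 1) * (k + 2) ^ 2 * (k + 3))) ?_ hc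
    rw [← hid]
    have : 0 ≤ s ^ (k + 3) := Real.rpow_nonneg hs0.le _
    positivity
  · have hfun : ∀ r : ℝ × ℝ, |t - t / s * r.1 - r.2| =
        |t + (t - t / s - t) * r.1 + (t - 1 - t) * r.2| := fun r => by
      congr 1
      ring
    simp only [hfun]
    have hs3 : 0 ≤ s ^ (k + 3) := Real.rpow_nonneg hs0.le _
    rw [hV, habs, ← ENNReal.ofReal_mul (by positivity), ← ENNReal.ofReal_mul (by positivity), hid]

theorem lintegral_originSeparated {k : ℝ} (hk : -1 < k) :
    ∫⁻ p in unitTriangle, ∫⁻ q in unitTriangle, originSeparated.indicator (innerMoment k) (p, q) =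
      ∫⁻ t in Set.Ioo (0 : ℝ) 1, ∫⁻ s in Set.Ioo (0 : ℝ) 1,
        ENNReal.ofReal (2 / ((k + 1) * (k + 2) ^ 2 * (k + 3)) * secantKernel (k + 2) s t) := by
  rw [lintegral_originSeparated_eq_line hk]
  refine setLIntegral_congr_fun measurableSet_Ioo fun t ht => ?_
  have himg : (fun s : ℝ => t / s) '' Set.Ioo 0 1 = Set.Ioi t := by
    ext b
    simp only [Set.mem_image, Set.mem_Ioo, Set.mem_Ioi]
    constructor
    · rintro ⟨s, ⟨h0, h1⟩, rfl⟩
      rw [lt_div_iff₀ h0]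
      nlinarith [ht.1]
    · intro hb
      have hb0 := ht.1.trans hb
      refine ⟨t / b, ⟨div_pos ht.1 hb0, (div_lt_one hb0).2 hb⟩, ?_⟩
      have := ht.1.ne'
      field_simp
  have h := lintegral_image_eq_lintegral_abs_deriv_mul (s := Set.Ioo (0 : ℝ) 1)
    (f := fun s : ℝ => t / s) (f' := fun s => -t / s ^ 2) measurableSet_Ioo
    (fun s hs => by
      have h := ((hasDerivAt_inv hs.1.ne').const_mul t).hasDerivWithinAt (s := Set.Ioo (0 : ℝ) 1)
      have e : t * -(s ^ 2)⁻¹ = -t / s ^ 2 := by ring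
      rw [e] at h
      exact h)
    (fun s hs s' hs' e => by
      have := ht.1.ne'
      have := hs.1.ne'
      have := hs'.1.ne'
      simp only at e
      field_simp at e
      exact e.symm)
    (fun b => ENNReal.ofReal (2 * (t / b) ^ (k + 3) / ((k + 2) * (k + 3))) *
          ∫⁻ r in unitTriangle, ENNReal.ofReal (|t - b * r.1 - r.2| ^ k))
  rw [himg] at h
  rw [h]
  refine setLIntegral_congr_fun_ae measurableSet_Ioo ?_
  filter_upwards [Measure.ae_ne volume t] with s hst hs
  rw [div_div_cancel₀ ht.1.ne']
  exact (secantKernel_spec hk hs ht hst).2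

/-- The difference quotient of `x ↦ x ^ p`. -/
noncomputable def rpowSlope (p x y : ℝ) : ℝ := (x ^ p - y ^ p) / (x - y)

theorem rpowSlope_comm (p x y : ℝ) : rpowSlope p x y = rpowSlope p y x := by
  rw [rpowSlope, rpowSlope, ← neg_sub (y ^ p), ← neg_sub y, neg_div_neg_eq]

theorem measurable_rpowSlope (p : ℝ) : Measurable fun q : ℝ × ℝ => rpowSlope p q.1 q.2 := by
  unfold rpowSlope
  fun_prop

theorem abs_rpowSlope_le {p : ℝ} (hp : 1 ≤ p) {x y : ℝ} (hx : x ∈ Set.Icc (0 : ℝ) 1)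
    (hy : y ∈ Set.Icc (0 : ℝ) 1) : |rpowSlope p x y| ≤ p := by
  have h := (convex_Icc (0 : ℝ) 1).norm_image_sub_le_of_norm_hasDerivWithin_le (C := p)
    (f := fun z : ℝ => z ^ p) (f' := fun z => p * z ^ (p - 1))
    (fun z _ => (Real.hasDerivAt_rpow_const (Or.inr hp)).hasDerivWithinAt)
    (fun z hz => by
      rw [Real.norm_eq_abs, abs_of_nonneg (mul_nonneg (by linarith) (Real.rpow_nonneg hz.1 _))]
      exact mul_le_of_le_one_right (by linarith)
        (Real.rpow_le_one hz.1 hz.2 (by linarith))) hy hx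
  rw [rpowSlope, abs_div]
  exact div_le_of_le_mul₀ (abs_nonneg _) (by linarith) h

theorem measurePreserving_one_sub_restrict_Ioo :
    MeasurePreserving (fun x : ℝ => 1 - x) (volume.restrict (Set.Ioo 0 1))
      (volume.restrict (Set.Ioo 0 1)) := by
  have h := (Measure.measurePreserving_sub_left (volume : Measure ℝ) 1).restrict_preimage
    (measurableSet_Ioo (a := (0 : ℝ)) (b := 1))
  rwa [Set.preimage_const_sub_Ioo, sub_self, sub_zero] at h

theorem measurePreserving_one_sub_prod_restrict_Ioo :
    MeasurePreserving (fun q : ℝ × ℝ => (1 - q.1, 1 - q.2))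
      ((volume.restrict (Set.Ioo 0 1)).prod (volume.restrict (Set.Ioo 0 1)))
      ((volume.restrict (Set.Ioo 0 1)).prod (volume.restrict (Set.Ioo 0 1))) :=
  measurePreserving_one_sub_restrict_Ioo.prod measurePreserving_one_sub_restrict_Ioo

theorem measurableEmbedding_one_sub : MeasurableEmbedding fun x : ℝ => 1 - x :=
  (MeasurableEquiv.subLeft (1 : ℝ)).measurableEmbedding

theorem ae_fst_ne_snd :
    ∀ᵐ q : ℝ × ℝ ∂((volume.restrict (Set.Ioo (0 : ℝ) 1)).prod (volume.restrict (Set.Ioo (0 : ℝ) 1))),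
      q.1 ≠ q.2 := by
  rw [ae_iff]
  simp only [ne_eq, not_not]
  rw [Measure.measure_prod_null (measurableSet_eq_fun measurable_fst measurable_snd)]
  refine Filter.Eventually.of_forall fun x => ?_
  have : Prod.mk x ⁻¹' {q : ℝ × ℝ | q.1 = q.2} = {x} := by
    ext y
    simp [eq_comm]
  change (volume.restrict (Set.Ioo (0 : ℝ) 1)) (Prod.mk x ⁻¹' {q : ℝ × ℝ | q.1 = q.2}) = 0
  rw [this]
  simp

theorem ae_mem_Ioo_prod :
    ∀ᵐ q : ℝ × ℝ ∂((volume.restrict (Set.Ioo (0 : ℝ) 1)).prod (volume.restrict (Set.Ioo (0 : ℝ) 1))),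
      q.1 ∈ Set.Ioo (0 : ℝ) 1 ∧ q.2 ∈ Set.Ioo (0 : ℝ) 1 := by
  rw [Measure.prod_restrict]
  exact ae_restrict_mem (measurableSet_Ioo.prod measurableSet_Ioo)

theorem integrable_of_abs_le {f : ℝ × ℝ → ℝ} (hf : Measurable f) (C : ℝ)
    (h : ∀ s ∈ Set.Ioo (0 : ℝ) 1, ∀ t ∈ Set.Ioo (0 : ℝ) 1, |f (s, t)| ≤ C) :
    Integrable f ((volume.restrict (Set.Ioo (0 : ℝ) 1)).prod (volume.restrict (Set.Ioo (0 : ℝ) 1))) := by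
  refine Integrable.of_bound hf.aestronglyMeasurable C ?_
  filter_upwards [ae_mem_Ioo_prod] with q hq
  exact h _ hq.1 _ hq.2

theorem integrable_mul_rpowSlope {p : ℝ} (hp : 1 ≤ p) {u : ℝ → ℝ} (hu : Measurable u)
    (hu1 : ∀ s ∈ Set.Ioo (0 : ℝ) 1, |u s| ≤ 1) :
    Integrable (fun q : ℝ × ℝ => u q.1 * rpowSlope p q.1 q.2)
      ((volume.restrict (Set.Ioo (0 : ℝ) 1)).prod (volume.restrict (Set.Ioo (0 : ℝ) 1))) := by
  refine integrable_of_abs_le ((hu.comp measurable_fst).mul (measurable_rpowSlope p)) (1 * p)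
    fun s hs t ht => ?_
  rw [abs_mul]
  exact mul_le_mul (hu1 s hs) (abs_rpowSlope_le hp (Set.Ioo_subset_Icc_self hs)
    (Set.Ioo_subset_Icc_self ht)) (abs_nonneg _) zero_le_one

theorem secantKernel_eq_rpowSlope {p s t : ℝ} (hst : s ≠ t) :
    secantKernel p s t = (s ^ p * t ^ p - s ^ p * (1 - t) ^ p) +
      (s * (1 - s) ^ p * rpowSlope p s t + s * s ^ p * rpowSlope p (1 - s) (1 - t)) := by
  have h : t - s ≠ 0 := sub_ne_zero.2 hst.symm
  rw [secantKernel, rpowSlope_comm p s t, rpowSlope, rpowSlope,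
    show 1 - s - (1 - t) = t - s by ring]
  field_simp
  ring

theorem abs_rpow_le_one_of_mem {p : ℝ} (hp : 0 ≤ p) {x : ℝ} (hx : x ∈ Set.Ioo (0 : ℝ) 1) :
    |x ^ p| ≤ 1 := by
  rw [abs_of_nonneg (Real.rpow_nonneg hx.1.le _)]
  exact Real.rpow_le_one hx.1.le hx.2.le hp

theorem one_sub_mem_Ioo {x : ℝ} (hx : x ∈ Set.Ioo (0 : ℝ) 1) : 1 - x ∈ Set.Ioo (0 : ℝ) 1 :=
  ⟨sub_pos.2 hx.2, sub_lt_self 1 hx.1⟩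

theorem integral_secantKernel {p : ℝ} (hp : 1 ≤ p) :
    Integrable (fun q : ℝ × ℝ => secantKernel p q.1 q.2)
      ((volume.restrict (Set.Ioo (0 : ℝ) 1)).prod (volume.restrict (Set.Ioo (0 : ℝ) 1))) ∧
    ∫ q : ℝ × ℝ, secantKernel p q.1 q.2
      ∂((volume.restrict (Set.Ioo (0 : ℝ) 1)).prod (volume.restrict (Set.Ioo (0 : ℝ) 1))) =
    ∫ x in Set.Icc (0 : ℝ) 1, ∫ y in Set.Icc (0 : ℝ) 1,
      (1 - x) ^ p * ((x ^ p - y ^ p) / (x - y)) := by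
  set ν := volume.restrict (Set.Ioo (0 : ℝ) 1) with hν
  have hp0 : 0 ≤ p := by linarith
  have hmem : ∀ s ∈ Set.Ioo (0 : ℝ) 1, |s| ≤ 1 := fun s hs => by
    rw [abs_of_pos hs.1]
    exact hs.2.le
  have hmul : ∀ {a b : ℝ}, |a| ≤ 1 → |b| ≤ 1 → |a * b| ≤ 1 := fun ha hb => by
    rw [abs_mul]
    exact mul_le_one₀ ha (abs_nonneg _) hb
  have i1 : Integrable (fun q : ℝ × ℝ => q.1 ^ p * q.2 ^ p) (ν.prod ν) :=
    integrable_of_abs_le (by fun_prop) 1 fun s hs t ht =>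
      hmul (abs_rpow_le_one_of_mem hp0 hs) (abs_rpow_le_one_of_mem hp0 ht)
  have i2 : Integrable (fun q : ℝ × ℝ => q.1 ^ p * (1 - q.2) ^ p) (ν.prod ν) :=
    integrable_of_abs_le (by fun_prop) 1 fun s hs t ht =>
      hmul (abs_rpow_le_one_of_mem hp0 hs) (abs_rpow_le_one_of_mem hp0 (one_sub_mem_Ioo ht))
  have i3 : Integrable (fun q : ℝ × ℝ => q.1 * (1 - q.1) ^ p * rpowSlope p q.1 q.2) (ν.prod ν) :=
    integrable_mul_rpowSlope (u := fun s => s * (1 - s) ^ p) hp (by fun_prop) fun s hs =>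
      hmul (hmem s hs) (abs_rpow_le_one_of_mem hp0 (one_sub_mem_Ioo hs))
  have i4 : Integrable (fun q : ℝ × ℝ => (1 - q.1) * (1 - q.1) ^ p * rpowSlope p q.1 q.2)
      (ν.prod ν) :=
    integrable_mul_rpowSlope (u := fun s => (1 - s) * (1 - s) ^ p) hp (by fun_prop) fun s hs =>
      hmul (hmem _ (one_sub_mem_Ioo hs)) (abs_rpow_le_one_of_mem hp0 (one_sub_mem_Ioo hs))
  have hemb : MeasurableEmbedding fun q : ℝ × ℝ => (1 - q.1, 1 - q.2) :=
    measurableEmbedding_one_sub.prodMap measurableEmbedding_one_sub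
  have hρ := measurePreserving_one_sub_prod_restrict_Ioo
  have hfun : (fun q : ℝ × ℝ => (1 - q.1) * (1 - q.1) ^ p * rpowSlope p q.1 q.2) ∘
      (fun q : ℝ × ℝ => (1 - q.1, 1 - q.2)) =
      fun q => q.1 * q.1 ^ p * rpowSlope p (1 - q.1) (1 - q.2) := by
    funext q
    simp only [Function.comp_apply, sub_sub_cancel]
  have i5 : Integrable (fun q : ℝ × ℝ => q.1 * q.1 ^ p * rpowSlope p (1 - q.1) (1 - q.2))
      (ν.prod ν) := by
    rw [← hfun]
    exact (hρ.integrable_comp_emb hemb).2 i4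
  have e45 : ∫ q : ℝ × ℝ, q.1 * q.1 ^ p * rpowSlope p (1 - q.1) (1 - q.2) ∂(ν.prod ν) =
      ∫ q : ℝ × ℝ, (1 - q.1) * (1 - q.1) ^ p * rpowSlope p q.1 q.2 ∂(ν.prod ν) := by
    rw [← hfun]
    exact hρ.integral_comp hemb
      (fun q : ℝ × ℝ => (1 - q.1) * (1 - q.1) ^ p * rpowSlope p q.1 q.2)
  have e12 : ∫ q : ℝ × ℝ, q.1 ^ p * (1 - q.2) ^ p ∂(ν.prod ν) =
      ∫ q : ℝ × ℝ, q.1 ^ p * q.2 ^ p ∂(ν.prod ν) := by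
    have h : ∫ t, (1 - t) ^ p ∂ν = ∫ t, t ^ p ∂ν :=
      measurePreserving_one_sub_restrict_Ioo.integral_comp measurableEmbedding_one_sub
        (fun t : ℝ => t ^ p)
    have h1 := integral_prod_mul (μ := ν) (ν := ν) (fun s : ℝ => s ^ p) (fun t : ℝ => (1 - t) ^ p)
    have h2 := integral_prod_mul (μ := ν) (ν := ν) (fun s : ℝ => s ^ p) (fun t : ℝ => t ^ p)
    rw [h1, h2, h]
  have hae : (fun q : ℝ × ℝ => secantKernel p q.1 q.2) =ᵐ[ν.prod ν] fun q =>
      (q.1 ^ p * q.2 ^ p - q.1 ^ p * (1 - q.2) ^ p) +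
      (q.1 * (1 - q.1) ^ p * rpowSlope p q.1 q.2 +
        q.1 * q.1 ^ p * rpowSlope p (1 - q.1) (1 - q.2)) := by
    filter_upwards [ae_fst_ne_snd] with q hq
    exact secantKernel_eq_rpowSlope hq
  refine ⟨((i1.sub i2).add (i3.add i5)).congr hae.symm, ?_⟩
  rw [integral_congr_ae hae]
  refine (integral_add (i1.sub i2) (i3.add i5)).trans
    ((congrArg₂ _ (integral_sub i1 i2) (integral_add i3 i5)).trans ?_)
  rw [e12, e45, sub_self, zero_add, ← restrict_Ioo_eq_restrict_Icc, ← hν]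
  refine (integral_add i3 i4).symm.trans ((integral_prod _ (i3.add i4)).trans ?_)
  refine integral_congr_ae (Filter.Eventually.of_forall fun x => ?_)
  refine integral_congr_ae (Filter.Eventually.of_forall fun y => ?_)
  simp only [rpowSlope, Pi.add_apply]
  ring

theorem lintegral_secantKernel {k : ℝ} (hk : -1 < k) {c : ℝ} (hc : 0 ≤ c) :
    ∫⁻ t in Set.Ioo (0 : ℝ) 1, ∫⁻ s in Set.Ioo (0 : ℝ) 1,
        ENNReal.ofReal (c * secantKernel (k + 2) s t) =
      ENNReal.ofReal (c * ∫ x in Set.Icc (0 : ℝ) 1, ∫ y in Set.Icc (0 : ℝ) 1,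
        (1 - x) ^ (k + 2) * ((x ^ (k + 2) - y ^ (k + 2)) / (x - y))) ∧
    0 ≤ ∫ x in Set.Icc (0 : ℝ) 1, ∫ y in Set.Icc (0 : ℝ) 1,
        (1 - x) ^ (k + 2) * ((x ^ (k + 2) - y ^ (k + 2)) / (x - y)) := by
  obtain ⟨hint, heq⟩ := integral_secantKernel (p := k + 2) (by linarith)
  have hnn : ∀ᵐ q : ℝ × ℝ ∂((volume.restrict (Set.Ioo (0 : ℝ) 1)).prod
      (volume.restrict (Set.Ioo (0 : ℝ) 1))), 0 ≤ secantKernel (k + 2) q.1 q.2 := by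
    filter_upwards [ae_fst_ne_snd, ae_mem_Ioo_prod] with q h1 h2
    exact (secantKernel_spec hk h2.1 h2.2 h1).1
  rw [← heq]
  refine ⟨?_, integral_nonneg_of_ae hnn⟩
  have hm : Measurable fun q : ℝ × ℝ => ENNReal.ofReal (c * secantKernel (k + 2) q.1 q.2) := by
    unfold secantKernel
    fun_prop
  rw [← lintegral_prod_symm _ hm.aemeasurable, ← integral_const_mul,
    ofReal_integral_eq_lintegral_ofReal (hint.const_mul c)]
  filter_upwards [hnn] with q hq
  exact mul_nonneg hc hq

/-- The affine map permuting the vertices of the unit triangle cyclically. -/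
def triangleRotation (p : ℝ × ℝ) : ℝ × ℝ := (p.2, 1 - p.2 - p.1)

theorem measurePreserving_triangleRotation :
    MeasurePreserving triangleRotation (volume.restrict unitTriangle)
      (volume.restrict unitTriangle) := by
  have h : MeasurePreserving triangleRotation (volume : Measure (ℝ × ℝ)) volume := by
    have h1 : MeasurePreserving (fun q : ℝ × ℝ => (q.1, 1 - q.1 - q.2))
        ((volume : Measure ℝ).prod volume) (volume.prod volume) :=
      (MeasurePreserving.id volume).skew_product (g := fun y x => 1 - y - x) (by fun_prop)
        (Filter.Eventually.of_forall fun y =>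
          (Measure.measurePreserving_sub_left (volume : Measure ℝ) (1 - y)).map_eq)
    exact h1.comp Measure.measurePreserving_swap
  have hpre : triangleRotation ⁻¹' unitTriangle = unitTriangle := by
    ext p
    simp only [triangleRotation, unitTriangle, Set.mem_preimage, Set.mem_ofPred_eq]
    constructor
    · rintro ⟨h1, h2, h3⟩
      exact ⟨by linarith, by linarith, by linarith⟩
    · rintro ⟨h1, h2, h3⟩
      exact ⟨by linarith, by linarith, by linarith⟩
  have := h.restrict_preimage measurableSet_unitTriangle
  rwa [hpre] at this

theorem tripleDet_triangleRotation (p q r : ℝ × ℝ) :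
    tripleDet (triangleRotation p) (triangleRotation q) (triangleRotation r) = tripleDet p q r := by
  simp only [tripleDet, triangleRotation]
  ring

theorem innerMoment_triangleRotation (k : ℝ) (p q : ℝ × ℝ) :
    innerMoment k (triangleRotation p, triangleRotation q) = innerMoment k (p, q) := by
  have hm : Measurable fun r => ENNReal.ofReal
      (|tripleDet (triangleRotation p) (triangleRotation q) r| ^ k) := by
    unfold tripleDet
    fun_prop
  rw [innerMoment, innerMoment, ← measurePreserving_triangleRotation.lintegral_comp hm]
  simp only [tripleDet_triangleRotation]

theorem ae_tripleDet_ne_zero (v : ℝ × ℝ) :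
    ∀ᵐ w : (ℝ × ℝ) × (ℝ × ℝ) ∂((volume.restrict unitTriangle).prod (volume.restrict unitTriangle)),
      tripleDet w.1 w.2 v ≠ 0 := by
  have hm : Measurable fun w : (ℝ × ℝ) × (ℝ × ℝ) => tripleDet w.1 w.2 v := by
    unfold tripleDet
    fun_prop
  have hfst : ∀ᵐ p : ℝ × ℝ, p.1 ≠ v.1 :=
    Measure.quasiMeasurePreserving_fst.ae (Measure.ae_ne volume v.1)
  rw [Measure.prod_restrict]
  refine ae_restrict_of_ae ?_
  refine (Measure.ae_prod_iff_ae_ae (p := fun w : (ℝ × ℝ) × (ℝ × ℝ) => tripleDet w.1 w.2 v ≠ 0)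
    (hm (measurableSet_singleton 0).compl)).2 ?_
  filter_upwards [hfst] with p hp
  have hm' : Measurable fun q : ℝ × ℝ => tripleDet p q v :=
    hm.comp (by fun_prop : Measurable fun q : ℝ × ℝ => (p, q))
  rw [Measure.volume_eq_prod]
  refine (Measure.ae_prod_iff_ae_ae (p := fun q : ℝ × ℝ => tripleDet p q v ≠ 0)
    (hm' (measurableSet_singleton 0).compl)).2 ?_
  refine Filter.Eventually.of_forall fun x' => ?_
  have hc : p.1 - v.1 ≠ 0 := sub_ne_zero.2 hp
  filter_upwards [Measure.ae_ne volume
    ((x' * p.2 - v.1 * p.2 - v.2 * (x' - p.1)) / (p.1 - v.1))] with y' hy' h0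
  refine hy' ?_
  simp only [tripleDet] at h0
  rw [eq_div_iff hc]
  linarith

theorem sum_indicator_originSeparated {w : (ℝ × ℝ) × (ℝ × ℝ)} (hw : w.1 ∈ unitTriangle)
    (h0 : tripleDet w.1 w.2 (0, 0) ≠ 0) (h1 : tripleDet w.1 w.2 (1, 0) ≠ 0)
    (h2 : tripleDet w.1 w.2 (0, 1) ≠ 0) (c : ENNReal) :
    originSeparated.indicator (fun _ => c) w +
      (originSeparated.indicator (fun _ => c) (Prod.map triangleRotation triangleRotation w) +
        originSeparated.indicator (fun _ => c) (Prod.map triangleRotation triangleRotation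
          (Prod.map triangleRotation triangleRotation w))) = c := by
  obtain ⟨p, q⟩ := w
  have e0 : triangleRotation (0, 0) = (0, 1) := by simp [triangleRotation]
  have e1 : triangleRotation (1, 0) = (0, 0) := by simp [triangleRotation]
  have e2 : triangleRotation (0, 1) = (1, 0) := by simp [triangleRotation]
  have hrot : ∀ p q : ℝ × ℝ,
      tripleDet (triangleRotation p) (triangleRotation q) (0, 0) = tripleDet p q (1, 0) ∧
      tripleDet (triangleRotation p) (triangleRotation q) (1, 0) = tripleDet p q (0, 1) ∧
      tripleDet (triangleRotation p) (triangleRotation q) (0, 1) = tripleDet p q (0, 0) :=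
    fun p q => ⟨by rw [← e1, tripleDet_triangleRotation], by rw [← e2, tripleDet_triangleRotation],
      by rw [← e0, tripleDet_triangleRotation]⟩
  have hbary : (1 - p.1 - p.2) * tripleDet p q (0, 0) + p.1 * tripleDet p q (1, 0) +
      p.2 * tripleDet p q (0, 1) = 0 := by
    simp only [tripleDet]
    ring
  obtain ⟨b1, b2, b3⟩ := hw
  simp only at b1 b2 b3 h0 h1 h2
  have m : ∀ p q : ℝ × ℝ, (p, q) ∈ originSeparated ↔
      tripleDet p q (0, 0) * tripleDet p q (1, 0) < 0 ∧
        tripleDet p q (0, 0) * tripleDet p q (0, 1) < 0 := fun p q => Iff.rfl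
  have m0 := m p q
  have m1 := m (triangleRotation p) (triangleRotation q)
  have m2 := m (triangleRotation (triangleRotation p)) (triangleRotation (triangleRotation q))
  simp only [(hrot _ _).1, (hrot _ _).2.1, (hrot _ _).2.2] at m1 m2
  simp only [Set.indicator, Prod.map_apply, m0, m1, m2]
  clear m0 m1 m2 m hrot e0 e1 e2
  generalize tripleDet p q (0, 0) = α at *
  generalize tripleDet p q (1, 0) = β at *
  generalize tripleDet p q (0, 1) = γ at *
  have b4 : 0 ≤ 1 - p.1 - p.2 := by linarith
  have hpos : ∀ {a b c : ℝ}, 0 < a → 0 < b → 0 < c →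
      0 < (1 - p.1 - p.2) * a + p.1 * b + p.2 * c := by
    intro a b c ha hb hc
    rcases b1.eq_or_lt with h | h
    · rcases b2.eq_or_lt with h' | h'
      · rw [← h, ← h']
        linarith
      · have := mul_pos h' hc
        positivity
    · have := mul_pos h hb
      positivity
  simp only [mul_neg_iff]
  rcases lt_or_gt_of_ne h0 with a0 | a0 <;> rcases lt_or_gt_of_ne h1 with a1 | a1 <;>
    rcases lt_or_gt_of_ne h2 with a2 | a2
  · exact absurd hbary (by linarith [hpos (neg_pos.2 a0) (neg_pos.2 a1) (neg_pos.2 a2)] : _ < _).ne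
  all_goals try simp [a0, a1, a2, a0.not_gt, a1.not_gt, a2.not_gt]
  exact absurd hbary (hpos a0 a1 a2).ne'

theorem lintegral_innerMoment (k : ℝ) :
    ∫⁻ p in unitTriangle, ∫⁻ q in unitTriangle, innerMoment k (p, q) =
      3 * ∫⁻ p in unitTriangle, ∫⁻ q in unitTriangle,
        originSeparated.indicator (innerMoment k) (p, q) := by
  set μ := (volume.restrict unitTriangle).prod (volume.restrict unitTriangle) with hμ
  set R := Prod.map triangleRotation triangleRotation with hR
  have hmp : MeasurePreserving R μ μ :=
    measurePreserving_triangleRotation.prod measurePreserving_triangleRotation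
  have hinv : ∀ w, innerMoment k (R w) = innerMoment k w := fun w =>
    innerMoment_triangleRotation k w.1 w.2
  set f := originSeparated.indicator (innerMoment k) with hf
  have hfm : Measurable f := (measurable_innerMoment k).indicator measurableSet_originSeparated
  rw [← lintegral_prod _ (measurable_innerMoment k).aemeasurable,
    ← lintegral_prod _ hfm.aemeasurable, ← hμ]
  have hae : innerMoment k =ᵐ[μ] fun w => f w + (f (R w) + f (R (R w))) := by
    have hmem : ∀ᵐ w ∂μ, w.1 ∈ unitTriangle :=
      Measure.quasiMeasurePreserving_fst.ae (ae_restrict_mem measurableSet_unitTriangle)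
    filter_upwards [ae_tripleDet_ne_zero (0, 0), ae_tripleDet_ne_zero (1, 0),
      ae_tripleDet_ne_zero (0, 1), hmem] with w h0 h1 h2 hw
    have h := sum_indicator_originSeparated hw h0 h1 h2 (innerMoment k w)
    simp only [hf, Set.indicator, hinv] at h ⊢
    exact h.symm
  have hfR : Measurable fun w => f (R w) := hfm.comp hmp.measurable
  rw [lintegral_congr_ae hae, lintegral_add_left hfm, lintegral_add_left hfR,
    hmp.lintegral_comp hfR, hmp.lintegral_comp hfm]
  ring

/-- The affine map sending `(0, 0)`, `(1, 0)`, `(0, 1)` to `A`, `B`, `C`. -/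
noncomputable def triangleParam (A B C : EuclideanSpace ℝ (Fin 2)) (p : ℝ × ℝ) :
    EuclideanSpace ℝ (Fin 2) :=
  A + (p.1 • (B - A) + p.2 • (C - A))

/-- Twice the signed area of the triangle `A B C`. -/
def euclideanDet (A B C : EuclideanSpace ℝ (Fin 2)) : ℝ :=
  (B 0 - A 0) * (C 1 - A 1) - (C 0 - A 0) * (B 1 - A 1)

theorem euclideanDet_triangleParam (A B C : EuclideanSpace ℝ (Fin 2)) (p q r : ℝ × ℝ) :
    euclideanDet (triangleParam A B C p) (triangleParam A B C q) (triangleParam A B C r) =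
      euclideanDet A B C * tripleDet p q r := by
  simp only [euclideanDet, triangleParam, tripleDet, PiLp.add_apply, PiLp.smul_apply,
    PiLp.sub_apply, smul_eq_mul]
  ring

theorem triangleParam_image_unitTriangle (A B C : EuclideanSpace ℝ (Fin 2)) :
    triangleParam A B C '' unitTriangle = convexHull ℝ {A, B, C} := by
  ext x
  rw [convexHull_insert (Set.insert_nonempty _ _), convexHull_pair]
  simp only [mem_convexJoin, Set.mem_singleton_iff, exists_eq_left, Set.mem_image]
  constructor
  · rintro ⟨⟨a, b⟩, ⟨h1, h2, h3⟩, rfl⟩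
    simp only at h1 h2 h3
    rcases (add_nonneg h1 h2).eq_or_lt with h | h
    · have ha : a = 0 := by linarith
      have hb : b = 0 := by linarith
      refine ⟨B, left_mem_segment _ _ _, ?_⟩
      simp only [triangleParam, ha, hb, zero_smul, add_zero]
      exact left_mem_segment _ _ _
    · refine ⟨(a / (a + b)) • B + (b / (a + b)) • C, ⟨a / (a + b), b / (a + b), by positivity,
        by positivity, by field_simp, rfl⟩, 1 - (a + b), a + b, by linarith, h.le, by ring, ?_⟩
      simp only [triangleParam]
      rw [smul_add, smul_smul, smul_smul, mul_div_cancel₀ _ h.ne', mul_div_cancel₀ _ h.ne']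
      module
  · rintro ⟨y, ⟨a, b, ha, hb, hab, rfl⟩, c, d, hc, hd, hcd, rfl⟩
    refine ⟨(d * a, d * b), ⟨by positivity, by positivity, ?_⟩, ?_⟩
    · simp only
      nlinarith
    · obtain rfl : c = 1 - d := by linarith
      obtain rfl : b = 1 - a := by linarith
      simp only [triangleParam]
      module

/-- The linear part of `triangleParam`, on Euclidean space. -/
noncomputable def triangleLinear (A B C : EuclideanSpace ℝ (Fin 2)) :
    EuclideanSpace ℝ (Fin 2) →ₗ[ℝ] EuclideanSpace ℝ (Fin 2) :=
  Matrix.toLpLin 2 2 !![B 0 - A 0, C 0 - A 0; B 1 - A 1, C 1 - A 1]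

theorem det_triangleLinear (A B C : EuclideanSpace ℝ (Fin 2)) :
    LinearMap.det (triangleLinear A B C) = euclideanDet A B C := by
  rw [triangleLinear, Matrix.toLpLin_eq_toLin, LinearMap.det_toLin, Matrix.det_fin_two_of,
    euclideanDet]

/-- The measurable identification of the product plane with the Euclidean plane. -/
noncomputable def planeEquiv : ℝ × ℝ ≃ᵐ EuclideanSpace ℝ (Fin 2) :=
  MeasurableEquiv.finTwoArrow.symm.trans (MeasurableEquiv.toLp 2 (Fin 2 → ℝ))

theorem measurePreserving_planeEquiv : MeasurePreserving planeEquiv :=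
  ((volume_preserving_finTwoArrow ℝ).symm _).trans (PiLp.volume_preserving_toLp (Fin 2))

theorem triangleParam_eq (A B C : EuclideanSpace ℝ (Fin 2)) (p : ℝ × ℝ) :
    triangleParam A B C p = A + triangleLinear A B C (planeEquiv p) := by
  ext i
  fin_cases i <;> simp [triangleParam, triangleLinear, planeEquiv, Matrix.toLpLin_apply]

theorem volume_unitTriangle : volume unitTriangle = ENNReal.ofReal (1 / 2) := by
  rw [← setLIntegral_one, setLIntegral_unitTriangle measurable_const]
  simp only [setLIntegral_one, Real.volume_Icc, sub_zero]
  rw [← ofReal_integral_eq_lintegral_ofReal]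
  · rw [integral_Icc_eq_integral_Ioc, ← intervalIntegral.integral_of_le zero_le_one]
    rw [intervalIntegral.integral_sub (by simp) (by simp), intervalIntegral.integral_const,
      integral_id]
    norm_num
  · exact (by fun_prop : Continuous fun x : ℝ => 1 - x).continuousOn.integrableOn_compact
      isCompact_Icc
  · exact (ae_restrict_iff' measurableSet_Icc).2 (Filter.Eventually.of_forall fun x hx =>
      sub_nonneg.2 hx.2)

theorem volume_convexHull_triple (A B C : EuclideanSpace ℝ (Fin 2)) :
    volume (convexHull ℝ {A, B, C}) = ENNReal.ofReal (|euclideanDet A B C| / 2) := by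
  have himg : convexHull ℝ {A, B, C} =
      (fun v => A + v) '' (triangleLinear A B C '' (planeEquiv '' unitTriangle)) := by
    rw [← triangleParam_image_unitTriangle, Set.image_image, Set.image_image]
    simp only [triangleParam_eq]
  have hvol : volume (planeEquiv '' unitTriangle) = volume unitTriangle := by
    rw [← measurePreserving_planeEquiv.measure_preimage_equiv, planeEquiv.preimage_image]
  rw [himg, Set.image_add_left, measure_preimage_add, Measure.addHaar_image_linearMap, hvol,
    volume_unitTriangle, det_triangleLinear, ← ENNReal.ofReal_mul (abs_nonneg _), mul_one_div]

theorem setIntegral_convexHull_triple {A B C : EuclideanSpace ℝ (Fin 2)}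
    (h : euclideanDet A B C ≠ 0) (f : EuclideanSpace ℝ (Fin 2) → ℝ) :
    ∫ x in convexHull ℝ {A, B, C}, f x =
      |euclideanDet A B C| * ∫ p in unitTriangle, f (triangleParam A B C p) := by
  have hdet : LinearMap.det (triangleLinear A B C) ≠ 0 := by rwa [det_triangleLinear]
  have hemb : MeasurableEmbedding (triangleParam A B C) := by
    refine Continuous.measurableEmbedding (by unfold triangleParam; fun_prop) fun p q hpq => ?_
    simp only [triangleParam_eq, add_right_inj] at hpq
    exact planeEquiv.injective ((LinearMap.equivOfDetNeZero _ hdet).injective hpq)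
  have hmap : Measure.map (triangleParam A B C) volume =
      ENNReal.ofReal |(euclideanDet A B C)⁻¹| • volume := by
    have hcomp : triangleParam A B C =
        (fun v => A + v) ∘ triangleLinear A B C ∘ planeEquiv := by
      funext p
      exact triangleParam_eq A B C p
    have hl : Measurable (triangleLinear A B C) :=
      (LinearMap.continuous_of_finiteDimensional _).measurable
    rw [hcomp, ← Measure.map_map (by fun_prop) (hl.comp planeEquiv.measurable),
      ← Measure.map_map hl planeEquiv.measurable, measurePreserving_planeEquiv.map_eq,
      Measure.map_linearMap_addHaar_eq_smul_addHaar _ hdet, Measure.map_smul,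
      map_add_left_eq_self, det_triangleLinear]
  have := hemb.setIntegral_map (μ := volume) f (convexHull ℝ {A, B, C})
  rw [← triangleParam_image_unitTriangle, hemb.injective.preimage_image, hmap,
    Measure.restrict_smul, integral_smul_measure, triangleParam_image_unitTriangle] at this
  rw [← this, ENNReal.toReal_ofReal (abs_nonneg _), smul_eq_mul, ← mul_assoc, ← abs_mul,
    mul_inv_cancel₀ h, abs_one, one_mul]

theorem integral_integral_integral_eq_toReal_lintegral {α β γ : Type*} [MeasurableSpace α]
    [MeasurableSpace β] [MeasurableSpace γ] {μ : Measure α} {ν : Measure β} {ρ : Measure γ}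
    [SFinite ν] [SFinite ρ] {f : α → β → γ → ℝ}
    (hf : Measurable fun w : (α × β) × γ => f w.1.1 w.1.2 w.2) (h0 : ∀ x y z, 0 ≤ f x y z)
    (hfin : ∫⁻ x, ∫⁻ y, ∫⁻ z, ENNReal.ofReal (f x y z) ∂ρ ∂ν ∂μ ≠ ⊤) :
    ∫ x, ∫ y, ∫ z, f x y z ∂ρ ∂ν ∂μ =
      (∫⁻ x, ∫⁻ y, ∫⁻ z, ENNReal.ofReal (f x y z) ∂ρ ∂ν ∂μ).toReal := by
  have hm1 : Measurable fun w : α × β => ∫⁻ z, ENNReal.ofReal (f w.1 w.2 z) ∂ρ :=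
    Measurable.lintegral_prod_right' (f := fun w : (α × β) × γ => ENNReal.ofReal (f w.1.1 w.1.2 w.2))
      hf.ennreal_ofReal
  have hm2 : Measurable fun x => ∫⁻ y, ∫⁻ z, ENNReal.ofReal (f x y z) ∂ρ ∂ν :=
    Measurable.lintegral_prod_right' hm1
  have hae := ae_lt_top hm2 hfin
  rw [← integral_toReal hm2.aemeasurable hae]
  refine integral_congr_ae ?_
  filter_upwards [hae] with x hx
  have hmx : Measurable fun y => ∫⁻ z, ENNReal.ofReal (f x y z) ∂ρ :=
    hm1.comp (by fun_prop : Measurable fun y : β => (x, y))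
  rw [← integral_toReal hmx.aemeasurable (ae_lt_top hmx hx.ne)]
  refine integral_congr_ae (Filter.Eventually.of_forall fun y => ?_)
  exact integral_eq_lintegral_of_nonneg_ae (Filter.Eventually.of_forall (h0 x y))
    (hf.comp (by fun_prop : Measurable fun z : γ => ((x, y), z))).aestronglyMeasurable

theorem integral_abs_tripleDet_rpow {k : ℝ} (hk : -1 < k) :
    ∫ p in unitTriangle, ∫ q in unitTriangle, ∫ r in unitTriangle, |tripleDet p q r| ^ k =
      6 / ((k + 1) * (k + 2) ^ 2 * (k + 3)) * ∫ x in Set.Icc (0 : ℝ) 1, ∫ y in Set.Icc (0 : ℝ) 1,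
        (1 - x) ^ (k + 2) * ((x ^ (k + 2) - y ^ (k + 2)) / (x - y)) := by
  have h1 : 0 < k + 1 := by linarith
  have h2 : 0 < k + 2 := by linarith
  have h3 : 0 < k + 3 := by linarith
  obtain ⟨hI, hI0⟩ := lintegral_secantKernel hk
    (by positivity : 0 ≤ 2 / ((k + 1) * (k + 2) ^ 2 * (k + 3)))
  have hval := lintegral_innerMoment k
  rw [lintegral_originSeparated hk, hI] at hval
  simp only [innerMoment] at hval
  rw [integral_integral_integral_eq_toReal_lintegral (f := fun p q r => |tripleDet p q r| ^ k)
    (by unfold tripleDet; fun_prop) (fun _ _ _ => by positivity)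
    (by rw [hval]; exact ENNReal.mul_ne_top (by norm_num) ENNReal.ofReal_ne_top), hval,
    ENNReal.toReal_mul, ENNReal.toReal_ofReal (by positivity)]
  simp only [ENNReal.toReal_ofNat]
  ring

/-- For any real `k > -1`, the k-th moment of the area of a triangle with i.i.d.
uniform vertices in a fixed triangle of unit area equals
`48/((1+k)(2+k)²(3+k)) · ∫₀¹∫₀¹ (1-x)^{2+k}(x^{2+k}-y^{2+k})/(x-y) dx dy`. -/
theorem stmt_1 (A B C : EuclideanSpace ℝ (Fin 2))
    (hT : volume (convexHull ℝ {A, B, C}) = 1) (k : ℝ) (hk : -1 < k) :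
    (∫ x₀ in convexHull ℝ {A, B, C}, ∫ x₁ in convexHull ℝ {A, B, C},
        ∫ x₂ in convexHull ℝ {A, B, C},
          (volume (convexHull ℝ {x₀, x₁, x₂})).toReal ^ k)
      = 48 / ((1 + k) * (2 + k) ^ 2 * (3 + k)) *
          ∫ x in Set.Icc (0:ℝ) 1, ∫ y in Set.Icc (0:ℝ) 1,
            (1 - x) ^ (2 + k) * ((x ^ (2 + k) - y ^ (2 + k)) / (x - y)) := by
  rw [volume_convexHull_triple, ENNReal.ofReal_eq_one] at hT
  have hdet : |euclideanDet A B C| = 2 := by linarith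
  have hne : euclideanDet A B C ≠ 0 := fun h => by simp [h] at hdet
  have harea : ∀ p q r, (volume (convexHull ℝ {triangleParam A B C p, triangleParam A B C q,
      triangleParam A B C r})).toReal = |tripleDet p q r| := fun p q r => by
    rw [volume_convexHull_triple, ENNReal.toReal_ofReal (by positivity),
      euclideanDet_triangleParam, abs_mul, hdet, mul_div_cancel_left₀ _ two_ne_zero]
  conv_lhs => simp only [setIntegral_convexHull_triple hne, harea, integral_const_mul, hdet]
  rw [integral_abs_tripleDet_rpow hk, add_comm 1 k, add_comm 2 k, add_comm 3 k]
  ring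
end

section
/- For every non-negative integer k, the k-th area moment of a random triangle in the unit square equals 24·H_{k+2} / (2^k (1+k)(2+k)^2(3+k)^2), where H_n is the n-th harmonic number. -/
open MeasureTheory

theorem convexHull_zero_single_single :
    convexHull ℝ {0, EuclideanSpace.single 0 1, EuclideanSpace.single 1 1} =
      {v : EuclideanSpace ℝ (Fin 2) | 0 ≤ v 0 ∧ 0 ≤ v 1 ∧ v 0 + v 1 ≤ 1} := by
  apply Set.Subset.antisymm
  · apply convexHull_min
    · rintro v (rfl | rfl | rfl) <;> simp
    · intro x hx y hy a b ha hb hab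
      obtain ⟨hx0, hx1, hx2⟩ := hx
      obtain ⟨hy0, hy1, hy2⟩ := hy
      refine ⟨?_, ?_, ?_⟩
      · simp only [PiLp.add_apply, PiLp.smul_apply, smul_eq_mul]; positivity
      · simp only [PiLp.add_apply, PiLp.smul_apply, smul_eq_mul]; positivity
      · simp only [PiLp.add_apply, PiLp.smul_apply, smul_eq_mul]
        nlinarith
  · rintro v ⟨h0, h1, h2⟩
    rw [convexHull_insert (by simp), convexHull_pair, mem_convexJoin]
    refine ⟨0, rfl, ?_⟩
    rcases (add_nonneg h0 h1).eq_or_lt with h | h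
    · refine ⟨_, left_mem_segment _ _ _, 1, 0, by simp, by simp, by simp, ?_⟩
      ext i
      fin_cases i <;> simp <;> linarith
    · refine ⟨(v 0 / (v 0 + v 1)) • EuclideanSpace.single 0 1 +
        (v 1 / (v 0 + v 1)) • EuclideanSpace.single 1 1,
        ⟨_, _, by positivity, by positivity, by field_simp, rfl⟩,
        1 - (v 0 + v 1), v 0 + v 1, by linarith, by linarith, by ring, ?_⟩
      ext i
      fin_cases i <;> simp <;> field_simp

theorem volume_standard_triangle :
    volume {v : EuclideanSpace ℝ (Fin 2) | 0 ≤ v 0 ∧ 0 ≤ v 1 ∧ v 0 + v 1 ≤ 1} =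
      ENNReal.ofReal (1 / 2) := by
  have hmp := ((volume_preserving_finTwoArrow ℝ).comp
    (PiLp.volume_preserving_ofLp (Fin 2)))
  set T : Set (ℝ × ℝ) := {p | 0 ≤ p.1 ∧ 0 ≤ p.2 ∧ p.1 + p.2 ≤ 1} with hT
  have hTm : MeasurableSet T := by
    exact (measurableSet_le measurable_const measurable_fst).inter
      ((measurableSet_le measurable_const measurable_snd).inter
        (measurableSet_le (measurable_fst.add measurable_snd) measurable_const))
  have := hmp.measure_preimage hTm.nullMeasurableSet
  refine this.trans ?_
  rw [Measure.volume_eq_prod, Measure.prod_apply hTm]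
  have hslice : ∀ x : ℝ, volume (Prod.mk x ⁻¹' T) =
      (Set.Icc (0 : ℝ) 1).indicator (fun x => ENNReal.ofReal (1 - x)) x := by
    intro x
    by_cases hx : x ∈ Set.Icc (0 : ℝ) 1
    · rw [Set.indicator_of_mem hx]
      have : Prod.mk x ⁻¹' T = Set.Icc 0 (1 - x) := by
        ext y
        simp only [hT, Set.mem_preimage, Set.mem_ofPred_eq, Set.mem_Icc]
        exact ⟨fun h => ⟨h.2.1, by linarith⟩, fun h => ⟨hx.1, h.1, by linarith⟩⟩
      rw [this, Real.volume_Icc, sub_zero]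
    · rw [Set.indicator_of_notMem hx]
      have : Prod.mk x ⁻¹' T = ∅ := by
        ext y
        simp only [hT, Set.mem_preimage, Set.mem_ofPred_eq, Set.mem_empty_iff_false, iff_false]
        exact fun h => hx ⟨h.1, by linarith⟩
      rw [this, measure_empty]
  simp_rw [hslice]
  rw [lintegral_indicator measurableSet_Icc, ← ofReal_integral_eq_lintegral_ofReal,
    integral_Icc_eq_integral_Ioc, ← intervalIntegral.integral_of_le zero_le_one]
  · congr 1
    rw [intervalIntegral.integral_sub (by simp) (by simp), integral_id]
    norm_num
  · exact (Continuous.integrableOn_Icc (by fun_prop))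
  · exact (ae_restrict_mem measurableSet_Icc).mono fun x hx => sub_nonneg.2 hx.2

theorem volume_convexHull_triple_s3 (x y z : EuclideanSpace ℝ (Fin 2)) :
    (volume (convexHull ℝ {x, y, z})).toReal =
      |x 0 * (y 1 - z 1) + y 0 * (z 1 - x 1) + z 0 * (x 1 - y 1)| / 2 := by
  set A : Matrix (Fin 2) (Fin 2) ℝ := !![y 0 - x 0, z 0 - x 0; y 1 - x 1, z 1 - x 1] with hA
  set L : EuclideanSpace ℝ (Fin 2) →ₗ[ℝ] EuclideanSpace ℝ (Fin 2) := Matrix.toEuclideanLin A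
  have h0 : L (EuclideanSpace.single 0 1) = y - x := by
    ext i
    fin_cases i <;> simp [L, hA]
  have h1 : L (EuclideanSpace.single 1 1) = z - x := by
    ext i
    fin_cases i <;> simp [L, hA]
  have himg : ({x, y, z} : Set (EuclideanSpace ℝ (Fin 2))) = (fun v => x + v) ''
      (L '' {0, EuclideanSpace.single 0 1, EuclideanSpace.single 1 1}) := by
    simp [Set.image_insert_eq, h0, h1]
  have hhull : convexHull ℝ ({x, y, z} : Set (EuclideanSpace ℝ (Fin 2))) = (fun v => x + v) ''
      (L '' convexHull ℝ {0, EuclideanSpace.single 0 1, EuclideanSpace.single 1 1}) := by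
    rw [himg, LinearMap.image_convexHull]
    exact (((AffineEquiv.constVAdd ℝ _ x).toAffineMap).image_convexHull _).symm
  have hdet : LinearMap.det L = A.det := LinearMap.det_toLpLin 2 A
  rw [hhull, Set.image_add_left, measure_preimage_add, Measure.addHaar_image_linearMap,
    convexHull_zero_single_single, volume_standard_triangle, hdet, hA, Matrix.det_fin_two_of,
    ENNReal.toReal_mul, ENNReal.toReal_ofReal (abs_nonneg _), ENNReal.toReal_ofReal (by norm_num),
    mul_one_div]
  congr 2
  ring

theorem intervalIntegral_triangle_swap {h : ℝ → ℝ → ℝ} (hh : Continuous (Function.uncurry h))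
    {s : ℝ} (hs : 0 ≤ s) :
    ∫ x in 0..s, ∫ y in 0..x, h x y = ∫ y in 0..s, ∫ x in y..s, h x y := by
  set S : Set (ℝ × ℝ) := {p | p.2 ≤ p.1} with hS
  have hSm : MeasurableSet S := measurableSet_le measurable_snd measurable_fst
  have hi : IntegrableOn (Function.uncurry fun x y => S.indicator (Function.uncurry h) (x, y))
      (Set.uIoc 0 s ×ˢ Set.uIoc 0 s) volume := by
    rw [Set.uIoc_of_le hs]
    have h1 : IntegrableOn (Function.uncurry h) (Set.Icc (0, 0) (s, s)) volume :=
      hh.integrableOn_Icc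
    refine ((h1.mono_set ?_).indicator hSm)
    rw [← Set.Icc_prod_Icc]
    exact Set.prod_mono Set.Ioc_subset_Icc_self Set.Ioc_subset_Icc_self
  have hsec : ∀ x y, S.indicator (Function.uncurry h) (x, y) = if y ≤ x then h x y else 0 := by
    intro x y
    simp [Set.indicator_apply, hS]
  have key := intervalIntegral_intervalIntegral_swap hi
  simp only [hsec] at key
  have hl : ∀ x ∈ Set.uIcc 0 s, ∫ y in 0..x, h x y = ∫ y in 0..s, if y ≤ x then h x y else 0 := by
    intro x hx
    rw [Set.uIcc_of_le hs] at hx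
    have := intervalIntegral.integral_indicator (f := fun y => h x y) (μ := volume) hx
    rw [← this]
    refine intervalIntegral.integral_congr fun y _ => ?_
    simp [Set.indicator_apply]
  have hr : ∀ y ∈ Set.uIcc 0 s, ∫ x in y..s, h x y = ∫ x in 0..s, if y ≤ x then h x y else 0 := by
    intro y hy
    rw [Set.uIcc_of_le hs] at hy
    rw [intervalIntegral.integral_of_le hs, intervalIntegral.integral_of_le hy.2,
      ← integral_Icc_eq_integral_Ioc, ← integral_Icc_eq_integral_Ioc]
    have : (fun x => if y ≤ x then h x y else 0) = (Set.Ici y).indicator fun x => h x y := by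
      ext x
      simp [Set.indicator_apply]
    rw [this, setIntegral_indicator measurableSet_Ici]
    congr 2
    ext x
    simp only [Set.mem_Icc, Set.mem_inter_iff, Set.mem_Ici]
    exact ⟨fun h => ⟨⟨hy.1.trans h.1, h.2⟩, h.1⟩, fun h => ⟨h.2, h.1.2⟩⟩
  rw [intervalIntegral.integral_congr hl, key, intervalIntegral.integral_congr hr]

theorem intervalIntegral_swap_of_continuous {h : ℝ → ℝ → ℝ}
    (hh : Continuous (Function.uncurry h)) (a b c d : ℝ) :
    ∫ x in a..b, ∫ y in c..d, h x y = ∫ y in c..d, ∫ x in a..b, h x y := by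
  refine intervalIntegral_intervalIntegral_swap ?_
  have h1 : IntegrableOn (Function.uncurry h) (Set.uIcc a b ×ˢ Set.uIcc c d) volume :=
    hh.continuousOn.integrableOn_compact (isCompact_uIcc.prod isCompact_uIcc)
  exact h1.mono_set (Set.prod_mono Set.uIoc_subset_uIcc Set.uIoc_subset_uIcc)

theorem intervalIntegral_square_of_symm {h : ℝ → ℝ → ℝ} (hh : Continuous (Function.uncurry h))
    (hsymm : ∀ x y, h x y = h y x) {s : ℝ} (hs : 0 ≤ s) :
    ∫ x in 0..s, ∫ y in 0..s, h x y = 2 * ∫ x in 0..s, ∫ y in 0..x, h x y := by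
  have hlow : Continuous fun x => ∫ y in 0..x, h x y := by fun_prop
  have hall : Continuous fun x => ∫ y in 0..s, h x y := by fun_prop
  have hsplit : ∀ y, ∫ x in y..s, h x y = (∫ x in 0..s, h y x) - ∫ x in 0..y, h y x := by
    intro y
    rw [intervalIntegral.integral_interval_sub_left]
    · exact intervalIntegral.integral_congr fun x _ => hsymm x y
    all_goals exact Continuous.intervalIntegrable (by fun_prop) _ _
  have key := intervalIntegral_triangle_swap hh hs
  rw [intervalIntegral.integral_congr fun y _ => hsplit y,
    intervalIntegral.integral_sub (hall.intervalIntegrable _ _) (hlow.intervalIntegrable _ _)]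
    at key
  linarith

theorem intervalIntegral_cube_of_symm {G : ℝ → ℝ → ℝ → ℝ}
    (hG : Continuous fun p : ℝ × ℝ × ℝ => G p.1 p.2.1 p.2.2)
    (hswap : ∀ x y z, G x y z = G y x z) (hrot : ∀ x y z, G x y z = G z x y) :
    ∫ x in 0..1, ∫ y in 0..1, ∫ z in 0..1, G x y z =
      3 * ∫ x in 0..1, ∫ y in 0..x, ∫ z in 0..x, G x y z := by
  have hsplit : ∀ x y, ∫ z in 0..1, G x y z = (∫ z in 0..x, G x y z) + ∫ z in x..1, G x y z := by
    intro x y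
    rw [intervalIntegral.integral_add_adjacent_intervals] <;>
      exact Continuous.intervalIntegrable (by fun_prop) _ _
  have hneg : ∀ x y, ∫ z in x..1, G x y z = -∫ z in 1..x, G x y z := fun x y =>
    intervalIntegral.integral_symm _ _
  have hc1 : Continuous fun x => ∫ y in 0..x, ∫ z in 0..x, G x y z := by fun_prop
  have hc2 : Continuous fun x => ∫ y in 0..x, ∫ z in x..1, G x y z := by
    simp_rw [hneg]
    fun_prop
  have hinner : ∀ x, ∫ y in 0..x, ∫ z in 0..1, G x y z =
      (∫ y in 0..x, ∫ z in 0..x, G x y z) + ∫ y in 0..x, ∫ z in x..1, G x y z := by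
    intro x
    simp_rw [hsplit]
    refine intervalIntegral.integral_add ?_ ?_ <;>
      exact Continuous.intervalIntegrable (by fun_prop) _ _
  have hhalf : ∀ z ∈ Set.uIcc (0 : ℝ) 1, ∫ x in 0..z, ∫ y in 0..x, G x y z =
      (1 / 2) * ∫ x in 0..z, ∫ y in 0..z, G z x y := by
    intro z hz
    rw [Set.uIcc_of_le zero_le_one] at hz
    have := intervalIntegral_square_of_symm (h := fun x y => G x y z) (by fun_prop)
      (fun x y => hswap x y z) hz.1
    have hz : ∀ x y, G z x y = G x y z := fun x y => (hrot x y z).symm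
    simp_rw [hz]
    rw [this]
    ring
  have hrest : ∫ x in 0..1, ∫ y in 0..x, ∫ z in x..1, G x y z =
      (1 / 2) * ∫ x in 0..1, ∫ y in 0..x, ∫ z in 0..x, G x y z := by
    have h1 : ∀ x, ∫ y in 0..x, ∫ z in x..1, G x y z = ∫ z in x..1, ∫ y in 0..x, G x y z :=
      fun x => intervalIntegral_swap_of_continuous (by fun_prop) _ _ _ _
    simp_rw [h1]
    rw [← intervalIntegral_triangle_swap (h := fun z x => ∫ y in 0..x, G x y z) (by fun_prop)
      zero_le_one, intervalIntegral.integral_congr hhalf, intervalIntegral.integral_const_mul]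
  rw [intervalIntegral_square_of_symm (h := fun x y => ∫ z in 0..1, G x y z) (by fun_prop)
    (fun x y => by simp_rw [hswap x y]) zero_le_one]
  simp_rw [hinner]
  rw [intervalIntegral.integral_add (hc1.intervalIntegrable _ _) (hc2.intervalIntegrable _ _),
    hrest]
  ring

theorem intervalIntegral_cube_of_homogeneous {G : ℝ → ℝ → ℝ → ℝ} (k : ℕ)
    (hG : Continuous fun p : ℝ × ℝ × ℝ => G p.1 p.2.1 p.2.2)
    (hswap : ∀ x y z, G x y z = G y x z) (hrot : ∀ x y z, G x y z = G z x y)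
    (hreflect : ∀ x y z, G (1 - x) (1 - y) (1 - z) = G x y z)
    (hhom : ∀ c x y z, 0 ≤ c → G (c * x) (c * y) (c * z) = c ^ k * G x y z) :
    ∫ x in 0..1, ∫ y in 0..1, ∫ z in 0..1, G x y z =
      6 / ((k + 2) * (k + 3)) * ∫ t in 0..1, G 0 1 t := by
  have hscale : ∀ (f : ℝ → ℝ) (x : ℝ), ∫ y in 0..x, f y = x * ∫ y in 0..1, f (x * y) := by
    intro f x
    simp
  have hreflect' : ∀ x y, G 1 x y = G 0 (1 - x) (1 - y) := by
    intro x y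
    rw [← hreflect]
    simp
  have hface : ∫ y in 0..1, ∫ z in 0..1, G 1 y z = 2 / (k + 2) * ∫ t in 0..1, G 0 1 t := by
    simp_rw [hreflect']
    have h1 : ∀ y, ∫ z in 0..1, G 0 (1 - y) (1 - z) = ∫ z in 0..1, G 0 (1 - y) z := by
      intro y
      simp
    have h2 := intervalIntegral.integral_comp_sub_left (a := 0) (b := 1)
      (fun y => ∫ z in 0..1, G 0 y z) 1
    simp only [sub_self, sub_zero] at h2
    simp_rw [h1]
    rw [h2, intervalIntegral_square_of_symm (by fun_prop)
      (fun y z => by rw [hrot, hswap, ← hrot, hswap, hrot, hrot]) zero_le_one]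
    have h3 : ∀ y ∈ Set.uIcc (0 : ℝ) 1, ∫ z in 0..y, G 0 y z =
        y ^ (k + 1) * ∫ t in 0..1, G 0 1 t := by
      intro y hy
      rw [Set.uIcc_of_le zero_le_one] at hy
      have h4 : ∀ t, G 0 y (y * t) = y ^ k * G 0 1 t := by
        intro t
        rw [← hhom y _ _ _ hy.1]
        simp
      rw [hscale]
      simp_rw [h4]
      rw [intervalIntegral.integral_const_mul]
      ring
    rw [intervalIntegral.integral_congr h3, intervalIntegral.integral_mul_const, integral_pow]
    push_cast
    field_simp
    norm_num
    ring
  have hface' : ∀ x ∈ Set.uIcc (0 : ℝ) 1, ∫ y in 0..x, ∫ z in 0..x, G x y z =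
      x ^ (k + 2) * ∫ y in 0..1, ∫ z in 0..1, G 1 y z := by
    intro x hx
    rw [Set.uIcc_of_le zero_le_one] at hx
    have h4 : ∀ y z, G x (x * y) (x * z) = x ^ k * G 1 y z := by
      intro y z
      rw [← hhom x _ _ _ hx.1, mul_one]
    rw [hscale]
    simp_rw [fun f => hscale f x, h4, intervalIntegral.integral_const_mul]
    ring
  rw [intervalIntegral_cube_of_symm hG hswap hrot, intervalIntegral.integral_congr hface',
    intervalIntegral.integral_mul_const, integral_pow, hface]
  push_cast
  field_simp
  norm_num
  ring

theorem integral_abs_sub_pow (k : ℕ) {m : ℝ} (hm : m ∈ Set.Icc (0 : ℝ) 1) :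
    ∫ x in 0..1, |m - x| ^ k = (m ^ (k + 1) + (1 - m) ^ (k + 1)) / (k + 1) := by
  have hint : ∀ a b : ℝ, IntervalIntegrable (fun x => |m - x| ^ k) volume a b :=
    fun a b => Continuous.intervalIntegrable (by fun_prop) _ _
  have h1 : ∫ x in 0..m, |m - x| ^ k = ∫ x in 0..m, (m - x) ^ k := by
    refine intervalIntegral.integral_congr fun x hx => ?_
    rw [Set.uIcc_of_le hm.1] at hx
    simp only [abs_of_nonneg (sub_nonneg.2 hx.2)]
  have h2 : ∫ x in m..1, |m - x| ^ k = ∫ x in m..1, (x - m) ^ k := by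
    refine intervalIntegral.integral_congr fun x hx => ?_
    rw [Set.uIcc_of_le hm.2] at hx
    simp only [abs_sub_comm m x, abs_of_nonneg (sub_nonneg.2 hx.1)]
  rw [← intervalIntegral.integral_add_adjacent_intervals (hint 0 m) (hint m 1), h1, h2,
    intervalIntegral.integral_comp_sub_left (fun x => x ^ k) m,
    intervalIntegral.integral_comp_sub_right (fun x => x ^ k) m]
  simp [integral_pow]
  ring

theorem integral_convexCombination_pow (m : ℕ) (a b : ℝ) :
    ∫ t in 0..1, (a * (1 - t) + b * t) ^ m =
      (∑ j ∈ Finset.range (m + 1), a ^ j * b ^ (m - j)) / (m + 1) := by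
  rcases eq_or_ne a b with rfl | hab
  · have h1 : ∀ t, (a * (1 - t) + a * t) ^ m = a ^ m := fun t => by ring
    have h2 : ∀ j ∈ Finset.range (m + 1), a ^ j * a ^ (m - j) = a ^ m := fun j hj => by
      rw [← pow_add, Nat.add_sub_cancel' (Finset.mem_range_succ_iff.1 hj)]
    rw [Finset.sum_congr rfl h2]
    simp_rw [h1]
    simp
    field_simp
  · have h1 : ∀ t, (a * (1 - t) + b * t) ^ m = (a + (b - a) * t) ^ m := fun t => by ring
    simp_rw [h1]
    have hba : b - a ≠ 0 := sub_ne_zero.2 hab.symm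
    have hgeom := (Commute.all a b).geom_sum₂_mul (m + 1)
    rw [intervalIntegral.integral_comp_add_mul (fun x => x ^ m) hba, integral_pow]
    simp only [add_tsub_cancel_right] at hgeom
    simp only [mul_zero, mul_one, add_zero, smul_eq_mul, add_sub_cancel]
    field_simp
    linarith

theorem sum_inv_mul_inv_reflect (m : ℕ) :
    ∑ j ∈ Finset.range (m + 1), 1 / ((j : ℝ) + 1) * (1 / (((m - j : ℕ) : ℝ) + 1)) =
      2 * (∑ j ∈ Finset.range (m + 1), 1 / ((j : ℝ) + 1)) / (m + 2) := by
  have hterm : ∀ j ∈ Finset.range (m + 1), 1 / ((j : ℝ) + 1) * (1 / (((m - j : ℕ) : ℝ) + 1)) =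
      (1 / ((j : ℝ) + 1) + 1 / (((m - j : ℕ) : ℝ) + 1)) / (m + 2) := by
    intro j hj
    have hcast : ((m - j : ℕ) : ℝ) + j = m := by
      exact_mod_cast Nat.sub_add_cancel (Finset.mem_range_succ_iff.1 hj)
    rw [← hcast]
    field_simp
    ring
  have hrefl := Finset.sum_range_reflect (fun j : ℕ => 1 / ((j : ℝ) + 1)) (m + 1)
  simp only [add_tsub_cancel_right] at hrefl
  rw [Finset.sum_congr rfl hterm, ← Finset.sum_div, Finset.sum_add_distrib, hrefl]
  ring

theorem integral_integral_integral_convexCombination_pow (m : ℕ) :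
    ∫ t in 0..1, ∫ a in 0..1, ∫ b in 0..1, ((a : ℝ) * (1 - t) + b * t) ^ m =
      2 * (∑ j ∈ Finset.range (m + 1), 1 / ((j : ℝ) + 1)) / ((m + 1) * (m + 2)) := by
  have hb : ∀ a : ℝ,
      ∫ b in 0..1, (∑ j ∈ Finset.range (m + 1), a ^ j * b ^ (m - j)) / ((m : ℝ) + 1) =
      (∑ j ∈ Finset.range (m + 1), a ^ j * (1 / (((m - j : ℕ) : ℝ) + 1))) / (m + 1) := by
    intro a
    rw [intervalIntegral.integral_div, intervalIntegral.integral_finsetSum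
      fun j _ => Continuous.intervalIntegrable (by fun_prop) _ _]
    simp [integral_pow]
  have ha : ∫ a in (0 : ℝ)..1,
      (∑ j ∈ Finset.range (m + 1), a ^ j * (1 / (((m - j : ℕ) : ℝ) + 1))) / ((m : ℝ) + 1) =
      (∑ j ∈ Finset.range (m + 1), 1 / ((j : ℝ) + 1) * (1 / (((m - j : ℕ) : ℝ) + 1))) / (m + 1) := by
    rw [intervalIntegral.integral_div, intervalIntegral.integral_finsetSum
      fun j _ => Continuous.intervalIntegrable (by fun_prop) _ _]
    simp [integral_pow]
  have hswap : ∀ a : ℝ, ∫ t in 0..1, ∫ b in 0..1, (a * (1 - t) + b * t) ^ m =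
      ∫ b in 0..1, ∫ t in 0..1, (a * (1 - t) + b * t) ^ m :=
    fun a => intervalIntegral_swap_of_continuous (by fun_prop) _ _ _ _
  rw [intervalIntegral_swap_of_continuous (by fun_prop)]
  simp_rw [hswap, integral_convexCombination_pow, hb]
  rw [ha, sum_inv_mul_inv_reflect]
  field_simp

theorem integral_integral_integral_abs_pow (k : ℕ) {t : ℝ} (ht : t ∈ Set.Icc (0 : ℝ) 1) :
    ∫ a in 0..1, ∫ b in 0..1, ∫ c in 0..1, |a * (1 - t) + b * t - c| ^ k =
      2 / (k + 1) * ∫ a in 0..1, ∫ b in 0..1, (a * (1 - t) + b * t) ^ (k + 1) := by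
  have hc : ∀ a ∈ Set.uIcc (0 : ℝ) 1, ∀ b ∈ Set.uIcc (0 : ℝ) 1,
      ∫ c in 0..1, |a * (1 - t) + b * t - c| ^ k =
      ((a * (1 - t) + b * t) ^ (k + 1) + (1 - (a * (1 - t) + b * t)) ^ (k + 1)) / (k + 1) := by
    intro a ha b hb
    rw [Set.uIcc_of_le zero_le_one] at ha hb
    refine integral_abs_sub_pow k ?_
    simpa [mul_comm] using convex_Icc (0 : ℝ) 1 ha hb (sub_nonneg.2 ht.2) ht.1 (by ring)
  have hreflect : ∫ a in 0..1, ∫ b in 0..1, (1 - (a * (1 - t) + b * t)) ^ (k + 1) =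
      ∫ a in 0..1, ∫ b in 0..1, (a * (1 - t) + b * t) ^ (k + 1) := by
    have h1 : ∀ a, ∫ b in 0..1, (1 - (a * (1 - t) + b * t)) ^ (k + 1) =
        ∫ b in 0..1, ((1 - a) * (1 - t) + b * t) ^ (k + 1) := by
      intro a
      have := intervalIntegral.integral_comp_sub_left (a := 0) (b := 1)
        (fun b => ((1 - a) * (1 - t) + b * t) ^ (k + 1)) 1
      simp only [sub_self, sub_zero] at this
      rw [← this]
      refine intervalIntegral.integral_congr fun b _ => ?_
      ring
    simp_rw [h1]
    have := intervalIntegral.integral_comp_sub_left (a := 0) (b := 1)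
      (fun a => ∫ b in 0..1, (a * (1 - t) + b * t) ^ (k + 1)) 1
    simpa using this
  have hb : ∀ a : ℝ, ∫ b in 0..1,
      ((a * (1 - t) + b * t) ^ (k + 1) + (1 - (a * (1 - t) + b * t)) ^ (k + 1)) / ((k : ℝ) + 1) =
      ((∫ b in 0..1, (a * (1 - t) + b * t) ^ (k + 1)) +
        ∫ b in 0..1, (1 - (a * (1 - t) + b * t)) ^ (k + 1)) / ((k : ℝ) + 1) := by
    intro a
    rw [intervalIntegral.integral_div, intervalIntegral.integral_add] <;>
      exact Continuous.intervalIntegrable (by fun_prop) _ _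
  rw [intervalIntegral.integral_congr fun a ha => intervalIntegral.integral_congr (hc a ha)]
  simp_rw [hb]
  rw [intervalIntegral.integral_div, intervalIntegral.integral_add, hreflect]
  · ring
  all_goals exact Continuous.intervalIntegrable (by fun_prop) _ _

theorem setIntegral_unitSquare {f : ℝ → ℝ → ℝ} (hf : Continuous (Function.uncurry f)) :
    ∫ v in {v : EuclideanSpace ℝ (Fin 2) | ∀ i, v i ∈ Set.Icc (0 : ℝ) 1}, f (v 0) (v 1) =
      ∫ a in 0..1, ∫ b in 0..1, f a b := by
  have hmp := (volume_preserving_finTwoArrow ℝ).comp (PiLp.volume_preserving_ofLp (Fin 2))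
  have hemb : MeasurableEmbedding
      (MeasurableEquiv.finTwoArrow ∘ (WithLp.ofLp : EuclideanSpace ℝ (Fin 2) → Fin 2 → ℝ)) :=
    MeasurableEquiv.finTwoArrow.measurableEmbedding.comp
      (MeasurableEquiv.toLp 2 (Fin 2 → ℝ)).symm.measurableEmbedding
  have hset : {v : EuclideanSpace ℝ (Fin 2) | ∀ i, v i ∈ Set.Icc (0 : ℝ) 1} =
      (MeasurableEquiv.finTwoArrow ∘ WithLp.ofLp) ⁻¹' (Set.Icc (0 : ℝ) 1 ×ˢ Set.Icc (0 : ℝ) 1) := by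
    ext v
    simp [Fin.forall_fin_two]
    tauto
  have key := hmp.setIntegral_preimage_emb hemb (Function.uncurry f)
    (Set.Icc (0 : ℝ) 1 ×ˢ Set.Icc (0 : ℝ) 1)
  rw [hset]
  refine Eq.trans key ?_
  rw [Measure.volume_eq_prod, setIntegral_prod]
  · simp_rw [integral_Icc_eq_integral_Ioc, ← intervalIntegral.integral_of_le zero_le_one]
    rfl
  · rw [← Measure.volume_eq_prod]
    exact hf.continuousOn.integrableOn_compact (isCompact_Icc.prod isCompact_Icc)

/-- The `k`-th moment of twice the area of a triangle whose ordinates are `y₀`, `y₁`, `y₂` and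
whose abscissae are independent and uniform in `[0, 1]`. -/
noncomputable def abscissaMoment (k : ℕ) (y₀ y₁ y₂ : ℝ) : ℝ :=
  ∫ a in 0..1, ∫ b in 0..1, ∫ c in 0..1, |a * (y₁ - y₂) + b * (y₂ - y₀) + c * (y₀ - y₁)| ^ k

theorem continuous_abscissaMoment (k : ℕ) :
    Continuous fun p : ℝ × ℝ × ℝ => abscissaMoment k p.1 p.2.1 p.2.2 := by
  unfold abscissaMoment
  fun_prop

theorem abscissaMoment_swap (k : ℕ) (x y z : ℝ) :
    abscissaMoment k x y z = abscissaMoment k y x z := by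
  unfold abscissaMoment
  rw [intervalIntegral_swap_of_continuous (by fun_prop)]
  refine intervalIntegral.integral_congr fun a _ => intervalIntegral.integral_congr fun b _ =>
    intervalIntegral.integral_congr fun c _ => ?_
  rw [← abs_neg]
  ring_nf

theorem abscissaMoment_rotate (k : ℕ) (x y z : ℝ) :
    abscissaMoment k x y z = abscissaMoment k z x y := by
  unfold abscissaMoment
  have h : ∀ a : ℝ, ∫ b in 0..1, ∫ c in 0..1, |a * (y - z) + b * (z - x) + c * (x - y)| ^ k =
      ∫ c in 0..1, ∫ b in 0..1, |a * (y - z) + b * (z - x) + c * (x - y)| ^ k :=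
    fun a => intervalIntegral_swap_of_continuous (by fun_prop) _ _ _ _
  simp_rw [h]
  rw [intervalIntegral_swap_of_continuous (by fun_prop)]
  refine intervalIntegral.integral_congr fun a _ => intervalIntegral.integral_congr fun b _ =>
    intervalIntegral.integral_congr fun c _ => ?_
  ring_nf

theorem abscissaMoment_reflect (k : ℕ) (x y z : ℝ) :
    abscissaMoment k (1 - x) (1 - y) (1 - z) = abscissaMoment k x y z := by
  unfold abscissaMoment
  refine intervalIntegral.integral_congr fun a _ => intervalIntegral.integral_congr fun b _ =>
    intervalIntegral.integral_congr fun c _ => ?_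
  rw [← abs_neg]
  ring_nf

theorem abscissaMoment_mul (k : ℕ) (r x y z : ℝ) (hr : 0 ≤ r) :
    abscissaMoment k (r * x) (r * y) (r * z) = r ^ k * abscissaMoment k x y z := by
  unfold abscissaMoment
  simp_rw [← intervalIntegral.integral_const_mul]
  refine intervalIntegral.integral_congr fun a _ => intervalIntegral.integral_congr fun b _ =>
    intervalIntegral.integral_congr fun c _ => ?_
  rw [← abs_of_nonneg (pow_nonneg hr k), ← abs_pow, ← abs_pow, ← abs_mul, ← mul_pow]
  ring_nf

theorem integral_abscissaMoment_zero_one (k : ℕ) :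
    ∫ t in 0..1, abscissaMoment k 0 1 t =
      4 * (∑ j ∈ Finset.range (k + 2), 1 / ((j : ℝ) + 1)) / ((k + 1) * (k + 2) * (k + 3)) := by
  have h : ∀ t ∈ Set.uIcc (0 : ℝ) 1, abscissaMoment k 0 1 t =
      2 / (k + 1) * ∫ a in 0..1, ∫ b in 0..1, (a * (1 - t) + b * t) ^ (k + 1) := by
    intro t ht
    rw [Set.uIcc_of_le zero_le_one] at ht
    rw [← integral_integral_integral_abs_pow k ht, abscissaMoment]
    refine intervalIntegral.integral_congr fun a _ => intervalIntegral.integral_congr fun b _ =>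
      intervalIntegral.integral_congr fun c _ => ?_
    ring_nf
  rw [intervalIntegral.integral_congr h, intervalIntegral.integral_const_mul,
    integral_integral_integral_convexCombination_pow]
  push_cast
  field_simp
  ring

theorem integral_iterated_coordinates (k : ℕ) :
    ∫ x₀ in 0..1, ∫ y₀ in 0..1, ∫ x₁ in 0..1, ∫ y₁ in 0..1, ∫ x₂ in 0..1, ∫ y₂ in 0..1,
        |(x₀ : ℝ) * (y₁ - y₂) + x₁ * (y₂ - y₀) + x₂ * (y₀ - y₁)| ^ k =
      ∫ y₀ in 0..1, ∫ y₁ in 0..1, ∫ y₂ in 0..1, abscissaMoment k y₀ y₁ y₂ := by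
  have h₂ : ∀ x₀ y₀ x₁ y₁ : ℝ, ∫ x₂ in 0..1, ∫ y₂ in 0..1,
        |x₀ * (y₁ - y₂) + x₁ * (y₂ - y₀) + x₂ * (y₀ - y₁)| ^ k =
      ∫ y₂ in 0..1, ∫ x₂ in 0..1, |x₀ * (y₁ - y₂) + x₁ * (y₂ - y₀) + x₂ * (y₀ - y₁)| ^ k :=
    fun x₀ y₀ x₁ y₁ => intervalIntegral_swap_of_continuous (by fun_prop) _ _ _ _
  have h₁ : ∀ x₀ y₀ : ℝ, ∫ x₁ in 0..1, ∫ y₁ in 0..1, ∫ y₂ in 0..1, ∫ x₂ in 0..1,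
        |x₀ * (y₁ - y₂) + x₁ * (y₂ - y₀) + x₂ * (y₀ - y₁)| ^ k =
      ∫ y₁ in 0..1, ∫ y₂ in 0..1, ∫ x₁ in 0..1, ∫ x₂ in 0..1,
        |x₀ * (y₁ - y₂) + x₁ * (y₂ - y₀) + x₂ * (y₀ - y₁)| ^ k := by
    intro x₀ y₀
    rw [intervalIntegral_swap_of_continuous (by fun_prop)]
    exact intervalIntegral.integral_congr fun y₁ _ =>
      intervalIntegral_swap_of_continuous (by fun_prop) _ _ _ _
  simp_rw [h₂, h₁]
  rw [intervalIntegral_swap_of_continuous (by fun_prop)]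
  refine intervalIntegral.integral_congr fun y₀ _ => ?_
  rw [intervalIntegral_swap_of_continuous (by fun_prop)]
  exact intervalIntegral.integral_congr fun y₁ _ =>
    intervalIntegral_swap_of_continuous (by fun_prop) _ _ _ _


/-- For every non-negative integer `k`, the k-th area moment of a random triangle in the
unit square equals `24·H_{k+2}/(2^k (1+k)(2+k)²(3+k)²)`, where `H_n` is the n-th
harmonic number. -/
theorem stmt_3 (k : ℕ) :
    (∫ x₀ in {x : EuclideanSpace ℝ (Fin 2) | ∀ i, x i ∈ Set.Icc (0:ℝ) 1},
        ∫ x₁ in {x : EuclideanSpace ℝ (Fin 2) | ∀ i, x i ∈ Set.Icc (0:ℝ) 1},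
          ∫ x₂ in {x : EuclideanSpace ℝ (Fin 2) | ∀ i, x i ∈ Set.Icc (0:ℝ) 1},
            (volume (convexHull ℝ {x₀, x₁, x₂})).toReal ^ k)
      = 24 * (∑ j ∈ Finset.range (k + 2), (1:ℝ) / ((j:ℝ) + 1)) /
          (2 ^ k * (1 + (k:ℝ)) * (2 + (k:ℝ)) ^ 2 * (3 + (k:ℝ)) ^ 2) := by
  have h₂ : ∀ x₀ x₁ : EuclideanSpace ℝ (Fin 2),
      ∫ x₂ in {x : EuclideanSpace ℝ (Fin 2) | ∀ i, x i ∈ Set.Icc (0:ℝ) 1},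
        (volume (convexHull ℝ {x₀, x₁, x₂})).toReal ^ k =
      (∫ a in 0..1, ∫ b in 0..1,
        |x₀ 0 * (x₁ 1 - b) + x₁ 0 * (b - x₀ 1) + a * (x₀ 1 - x₁ 1)| ^ k) / 2 ^ k := by
    intro x₀ x₁
    simp_rw [volume_convexHull_triple_s3, div_pow]
    rw [integral_div]
    congr 1
    exact setIntegral_unitSquare
      (f := fun a b => |x₀ 0 * (x₁ 1 - b) + x₁ 0 * (b - x₀ 1) + a * (x₀ 1 - x₁ 1)| ^ k)
      (by fun_prop)
  have h₁ : ∀ x₀ : EuclideanSpace ℝ (Fin 2),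
      ∫ x₁ in {x : EuclideanSpace ℝ (Fin 2) | ∀ i, x i ∈ Set.Icc (0:ℝ) 1},
        ∫ a in 0..1, ∫ b in 0..1,
          |x₀ 0 * (x₁ 1 - b) + x₁ 0 * (b - x₀ 1) + a * (x₀ 1 - x₁ 1)| ^ k =
      ∫ c in 0..1, ∫ d in 0..1, ∫ a in 0..1, ∫ b in 0..1,
        |x₀ 0 * (d - b) + c * (b - x₀ 1) + a * (x₀ 1 - d)| ^ k :=
    fun x₀ => setIntegral_unitSquare (f := fun c d => ∫ a in 0..1, ∫ b in 0..1,
      |x₀ 0 * (d - b) + c * (b - x₀ 1) + a * (x₀ 1 - d)| ^ k) (by fun_prop)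
  simp_rw [h₂, integral_div, h₁]
  rw [setIntegral_unitSquare (f := fun p q => ∫ c in 0..1, ∫ d in 0..1, ∫ a in 0..1, ∫ b in 0..1,
      |p * (d - b) + c * (b - q) + a * (q - d)| ^ k) (by fun_prop),
    integral_iterated_coordinates,
    intervalIntegral_cube_of_homogeneous k (continuous_abscissaMoment k) (abscissaMoment_swap k)
      (abscissaMoment_rotate k) (abscissaMoment_reflect k) (abscissaMoment_mul k),
    integral_abscissaMoment_zero_one]
  field_simp
  ring
end
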